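/- arXiv:1405.1903 — 5 statements merged into one kernel-verified Lean document; each statement's English description precedes it below -/
import Mathlib

section
/- Let Ω ⊆ ℝ^k be a bounded connected open set and let D be a uniformly elliptic second-order operator on Ω with continuous coefficients that are bounded on Ω. Suppose u, w : cl(Ω) → ℝ are continuous on the closure cl(Ω), twice continuously differentiable in Ω, satisfy D u ≥ 0 and D w ≤ 0 pointwise in Ω, and u > 0 at every point of cl(Ω). If there is a point x₀ ∈ Ω such that w(x₀)/u(x₀) ≥ 0 and w(x)/u(x) ≤ w(x₀)/u(x₀) for all x ∈ Ω, then the function w/u is constant on Ω. -/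
open Set

/-- The `i`-th partial derivative of `f : ℝᵏ → ℝ`. -/
noncomputable def pd {k : ℕ} (i : Fin k) (f : EuclideanSpace ℝ (Fin k) → ℝ) :
    EuclideanSpace ℝ (Fin k) → ℝ :=
  fun x => fderiv ℝ f x (EuclideanSpace.single i 1)

/-- The second-order operator `D f = -∑ᵢⱼ aᵢⱼ ∂ᵢ∂ⱼ f + ∑ᵢ bᵢ ∂ᵢ f + c f`. -/
noncomputable def secondOrderOp {k : ℕ}
    (a : EuclideanSpace ℝ (Fin k) → Fin k → Fin k → ℝ)
    (b : EuclideanSpace ℝ (Fin k) → Fin k → ℝ)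
    (c : EuclideanSpace ℝ (Fin k) → ℝ)
    (f : EuclideanSpace ℝ (Fin k) → ℝ) :
    EuclideanSpace ℝ (Fin k) → ℝ :=
  fun x => -(∑ i, ∑ j, a x i j * pd i (pd j f) x)
      + (∑ i, b x i * pd i f x) + c x * f x

open Filter Topology

/-- The second-order necessary condition at a local minimum. -/
theorem IsLocalMin.fderiv_fderiv_apply_nonneg {E : Type*} [NormedAddCommGroup E]
    [NormedSpace ℝ E] {g : E → ℝ} {p : E} (hmin : IsLocalMin g p) (hg : ContDiffAt ℝ 2 g p)
    (ξ : E) : 0 ≤ fderiv ℝ (fderiv ℝ g) p ξ ξ := by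
  set l : ℝ → E := fun t => p + t • ξ with hl
  have hl0 : l 0 = p := by simp [hl]
  have hld : ∀ t, HasDerivAt l ξ t := fun t => by
    simpa [hl] using ((hasDerivAt_id t).smul_const ξ).const_add p
  have hlc : Tendsto l (𝓝 0) (𝓝 p) := by
    simpa [hl0] using (hld 0).continuousAt.tendsto
  have hdiff : ∀ᶠ x in 𝓝 p, DifferentiableAt ℝ g x :=
    (hg.eventually (by simp)).mono fun x hx => hx.differentiableAt (by simp)
  have hφ : ∀ᶠ t in 𝓝 (0 : ℝ), HasDerivAt (g ∘ l) (fderiv ℝ g (l t) ξ) t :=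
    (hlc.eventually hdiff).mono fun t ht => ht.hasFDerivAt.comp_hasDerivAt t (hld t)
  have hdφ : deriv (g ∘ l) =ᶠ[𝓝 0] fun t => fderiv ℝ g (l t) ξ := hφ.mono fun t ht => ht.deriv
  have hB : DifferentiableAt ℝ (fderiv ℝ g) (l 0) := by
    rw [hl0]
    exact (hg.fderiv_right (m := 1) (by norm_num)).differentiableAt (by simp)
  have hddφ : deriv (deriv (g ∘ l)) 0 = fderiv ℝ (fderiv ℝ g) p ξ ξ := by
    rw [hdφ.deriv_eq, ← hl0]
    have h := (hB.hasFDerivAt.comp_hasDerivAt (0 : ℝ) (hld 0)).clm_apply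
      (hasDerivAt_const (0 : ℝ) ξ)
    simpa using h.deriv
  have hφmin : IsLocalMin (g ∘ l) 0 := by
    have := hlc.eventually hmin
    simpa [IsLocalMin, IsMinFilter, hl0] using this
  by_contra! hneg
  rw [← hddφ] at hneg
  have hφmax := isLocalMax_of_deriv_deriv_neg hneg hφmin.deriv_eq_zero
    hφ.self_of_nhds.continuousAt
  have hconst : g ∘ l =ᶠ[𝓝 0] fun _ => (g ∘ l) 0 := by
    filter_upwards [hφmin, hφmax] with t h₁ h₂ using le_antisymm h₂ h₁
  have hzero : deriv (g ∘ l) =ᶠ[𝓝 0] fun _ => (0 : ℝ) := by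
    simpa using hconst.deriv
  rw [hzero.deriv_eq] at hneg
  simp at hneg

/-- The contraction of a positive semidefinite matrix with a nonnegative bilinear form is
nonnegative. -/
theorem sum_sum_mul_bilin_nonneg {ι E : Type*} [Fintype ι] [NormedAddCommGroup E]
    [NormedSpace ℝ E] {A : ι → ι → ℝ} (hsymm : ∀ i j, A i j = A j i)
    (hA : ∀ ξ : ι → ℝ, 0 ≤ ∑ i, ∑ j, A i j * ξ i * ξ j)
    {B : E →L[ℝ] E →L[ℝ] ℝ} (hB : ∀ ξ, 0 ≤ B ξ ξ) (v : ι → E) :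
    0 ≤ ∑ i, ∑ j, A i j * B (v i) (v j) := by
  have hpsd : (Matrix.of A).PosSemidef := by
    rw [Matrix.posSemidef_iff_dotProduct_mulVec]
    refine ⟨Matrix.IsHermitian.ext fun i j => by simpa using hsymm j i, fun ξ => ?_⟩
    refine (hA ξ).trans_eq ?_
    simp only [dotProduct, Matrix.mulVec, Finset.mul_sum, Matrix.of_apply, star_trivial]
    exact Finset.sum_congr rfl fun i _ => Finset.sum_congr rfl fun j _ => by ring
  obtain ⟨m, s, hs⟩ := Matrix.posSemidef_iff_eq_sum_vecMulVec.mp hpsd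
  have hAs : ∀ i j, A i j = ∑ l, s l i * s l j := fun i j => by
    have := congrFun (congrFun hs i) j
    simpa [Matrix.sum_apply, Matrix.vecMulVec_apply] using this
  have key : ∑ i, ∑ j, A i j * B (v i) (v j)
      = ∑ l, B (∑ i, s l i • v i) (∑ j, s l j • v j) := by
    simp only [hAs, map_sum, map_smul, FunLike.coe_sum, FunLike.coe_smul,
      Finset.sum_apply, Pi.smul_apply, smul_eq_mul, Finset.sum_mul, Finset.mul_sum]
    simp_rw [Finset.sum_comm (s := Finset.univ (α := ι)) (t := Finset.univ (α := Fin m))]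
    refine Finset.sum_congr rfl fun l _ => ?_
    rw [Finset.sum_comm]
    exact Finset.sum_congr rfl fun j _ => Finset.sum_congr rfl fun i _ => by ring
  rw [key]
  exact Finset.sum_nonneg fun l _ => hB _

section Operator

variable {k : ℕ} {a : EuclideanSpace ℝ (Fin k) → Fin k → Fin k → ℝ}
  {b : EuclideanSpace ℝ (Fin k) → Fin k → ℝ} {c : EuclideanSpace ℝ (Fin k) → ℝ}
  {f g : EuclideanSpace ℝ (Fin k) → ℝ} {x : EuclideanSpace ℝ (Fin k)}

theorem pd_pd_eq_fderiv_fderiv (hf : ContDiffAt ℝ 2 f x) (i j : Fin k) :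
    pd i (pd j f) x = fderiv ℝ (fderiv ℝ f) x (EuclideanSpace.single i 1)
      (EuclideanSpace.single j 1) := by
  have hB : DifferentiableAt ℝ (fderiv ℝ f) x :=
    (hf.fderiv_right (m := 1) (by norm_num)).differentiableAt (by simp)
  have h := hB.hasFDerivAt.clm_apply
    (hasFDerivAt_const (EuclideanSpace.single j (1 : ℝ)) x)
  unfold pd
  rw [h.fderiv]
  simp

theorem pd_linear_comb (hf : DifferentiableAt ℝ f x) (hg : DifferentiableAt ℝ g x) (r s : ℝ)
    (i : Fin k) : pd i (fun y => r * f y + s * g y) x = r * pd i f x + s * pd i g x := by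
  unfold pd
  rw [show fderiv ℝ (fun y => r * f y + s * g y) x = _ from
    ((hf.hasFDerivAt.const_mul r).add (hg.hasFDerivAt.const_mul s)).fderiv]
  simp

theorem pd_congr_of_eventuallyEq (h : f =ᶠ[𝓝 x] g) (i : Fin k) : pd i f x = pd i g x := by
  unfold pd
  rw [h.fderiv_eq]

theorem ContDiffAt.differentiableAt_pd (hf : ContDiffAt ℝ 2 f x) (i : Fin k) :
    DifferentiableAt ℝ (pd i f) x :=
  ((hf.fderiv_right (m := 1) (by norm_num)).differentiableAt (by simp)).clm_apply
    (differentiableAt_const _)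

theorem pd_pd_linear_comb (hf : ContDiffAt ℝ 2 f x) (hg : ContDiffAt ℝ 2 g x) (r s : ℝ)
    (i j : Fin k) :
    pd i (pd j fun y => r * f y + s * g y) x = r * pd i (pd j f) x + s * pd i (pd j g) x := by
  rw [← pd_linear_comb (hf.differentiableAt_pd j) (hg.differentiableAt_pd j)]
  refine pd_congr_of_eventuallyEq ?_ i
  filter_upwards [hf.eventually (by simp), hg.eventually (by simp)] with y hfy hgy
  exact pd_linear_comb (hfy.differentiableAt (by simp)) (hgy.differentiableAt (by simp)) r s j

theorem secondOrderOp_linear_comb (hf : ContDiffAt ℝ 2 f x) (hg : ContDiffAt ℝ 2 g x)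
    (r s : ℝ) :
    secondOrderOp a b c (fun y => r * f y + s * g y) x
      = r * secondOrderOp a b c f x + s * secondOrderOp a b c g x := by
  simp only [secondOrderOp, pd_pd_linear_comb hf hg,
    pd_linear_comb (hf.differentiableAt (by simp)) (hg.differentiableAt (by simp)),
    mul_add, Finset.sum_add_distrib, mul_left_comm _ r, mul_left_comm _ s, ← Finset.mul_sum]
  ring

/-- An operator with nonnegative zeroth-order coefficient is nonpositive at a nonpositive
local minimum. -/
theorem secondOrderOp_nonpos_of_isLocalMin (hsymm : ∀ i j, a x i j = a x j i)
    (ha : ∀ ξ : Fin k → ℝ, 0 ≤ ∑ i, ∑ j, a x i j * ξ i * ξ j) (hc : 0 ≤ c x)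
    (hf : ContDiffAt ℝ 2 f x) (hmin : IsLocalMin f x) (hfx : f x ≤ 0) :
    secondOrderOp a b c f x ≤ 0 := by
  have h₁ := sum_sum_mul_bilin_nonneg hsymm ha (hmin.fderiv_fderiv_apply_nonneg hf)
    (fun i => EuclideanSpace.single i (1 : ℝ))
  have h₂ : ∀ i, pd i f x = 0 := fun i => by simp [pd, hmin.fderiv_eq_zero]
  simp only [secondOrderOp, pd_pd_eq_fderiv_fderiv hf, h₂, mul_zero, Finset.sum_const_zero]
  have := mul_nonpos_of_nonneg_of_nonpos hc hfx
  linarith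

theorem pd_exp_barrier (α : ℝ) (y : EuclideanSpace ℝ (Fin k)) (r : ℝ) (i : Fin k) :
    pd i (fun x => Real.exp (-α * ‖x - y‖ ^ 2) - r)
      = fun x => -2 * α * (x i - y i) * Real.exp (-α * ‖x - y‖ ^ 2) := by
  funext x
  have h := ((((hasFDerivAt_id x).sub_const y).norm_sq.const_mul (-α)).exp).sub_const r
  unfold pd
  rw [show fderiv ℝ (fun x => Real.exp (-α * ‖x - y‖ ^ 2) - r) x = _ from h.fderiv]
  simp [EuclideanSpace.inner_single_right]
  ring

theorem pd_pd_exp_barrier (α : ℝ) (y : EuclideanSpace ℝ (Fin k)) (r : ℝ) (i j : Fin k) :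
    pd i (pd j fun x => Real.exp (-α * ‖x - y‖ ^ 2) - r) x
      = (4 * α ^ 2 * ((x i - y i) * (x j - y j)) - if i = j then 2 * α else 0)
        * Real.exp (-α * ‖x - y‖ ^ 2) := by
  have h := ((((hasFDerivAt_id x).sub_const y).norm_sq.const_mul (-α)).exp)
  have h' := (((EuclideanSpace.proj j : EuclideanSpace ℝ (Fin k) →L[ℝ] ℝ).hasFDerivAt
    (x := x)).sub_const (y j)).const_mul (-2 * α)
  rw [pd_exp_barrier]
  unfold pd
  rw [show fderiv ℝ (fun x => -2 * α * (x j - y j) * Real.exp (-α * ‖x - y‖ ^ 2)) x = _ from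
    (h'.mul h).fderiv]
  simp [EuclideanSpace.inner_single_right, PiLp.single_apply, eq_comm (a := j) (b := i)]
  split_ifs <;> ring

/-- The barrier `exp (-α ‖x - y‖²) - r` is a strict subsolution away from `y` for large `α`. -/
theorem secondOrderOp_exp_barrier_neg {M e α δ S r : ℝ} {y : EuclideanSpace ℝ (Fin k)}
    (hM : 0 ≤ M) (he : 0 ≤ e) (hα : 0 ≤ α) (hδ : 0 ≤ δ) (hr : 0 ≤ r)
    (ha : ∀ i, |a x i i| ≤ M) (hb : ∀ i, |b x i| ≤ M)
    (hell : ∀ ξ : Fin k → ℝ, e * ∑ i, (ξ i) ^ 2 ≤ ∑ i, ∑ j, a x i j * ξ i * ξ j)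
    (hδx : δ ≤ ‖x - y‖) (hxS : ‖x - y‖ ≤ S)
    (hlarge : 2 * α * (k * M) + 2 * α * (k * (M * S)) + M < 4 * α ^ 2 * (e * δ ^ 2)) :
    secondOrderOp a b (fun _ => M) (fun x => Real.exp (-α * ‖x - y‖ ^ 2) - r) x < 0 := by
  set E := Real.exp (-α * ‖x - y‖ ^ 2) with hE
  have hEpos : 0 < E := Real.exp_pos _
  have hop : secondOrderOp a b (fun _ => M) (fun x => Real.exp (-α * ‖x - y‖ ^ 2) - r) x
      = E * (-(4 * α ^ 2 * ∑ i, ∑ j, a x i j * (x i - y i) * (x j - y j))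
        + 2 * α * ∑ i, a x i i - 2 * α * ∑ i, b x i * (x i - y i) + M) - M * r := by
    have h₁ : ∑ i, ∑ j, a x i j *
        pd i (pd j fun x => Real.exp (-α * ‖x - y‖ ^ 2) - r) x
        = E * (4 * α ^ 2 * ∑ i, ∑ j, a x i j * (x i - y i) * (x j - y j)
          - 2 * α * ∑ i, a x i i) := by
      have h : ∑ i, a x i i = ∑ i, ∑ j, a x i j * if i = j then 1 else 0 := by simp
      rw [h]
      simp only [pd_pd_exp_barrier, Finset.mul_sum, ← Finset.sum_sub_distrib]
      refine Finset.sum_congr rfl fun i _ => Finset.sum_congr rfl fun j _ => ?_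
      split_ifs <;> ring
    have h₂ : ∑ i, b x i * pd i (fun x => Real.exp (-α * ‖x - y‖ ^ 2) - r) x
        = -(E * (2 * α * ∑ i, b x i * (x i - y i))) := by
      simp only [pd_exp_barrier, Finset.mul_sum, ← Finset.sum_neg_distrib]
      exact Finset.sum_congr rfl fun i _ => by ring
    simp only [secondOrderOp, h₁, h₂, ← hE]
    ring
  have hquad : e * δ ^ 2 ≤ ∑ i, ∑ j, a x i j * (x i - y i) * (x j - y j) := by
    refine le_trans ?_ (hell fun i => x i - y i)
    have : ∑ i, (x i - y i) ^ 2 = ‖x - y‖ ^ 2 := by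
      simp [EuclideanSpace.norm_sq_eq]
    rw [this]
    gcongr
  have htrace : ∑ i, a x i i ≤ k * M := by
    simpa using Finset.sum_le_sum fun i (_ : i ∈ Finset.univ) => (le_abs_self _).trans (ha i)
  have hdrift : -∑ i, b x i * (x i - y i) ≤ k * (M * S) := by
    rw [← Finset.sum_neg_distrib]
    have : ∀ i ∈ Finset.univ, -(b x i * (x i - y i)) ≤ M * S := fun i _ => by
      refine (neg_le_abs _).trans ?_
      rw [abs_mul]
      have hi : |x i - y i| ≤ S := by
        simpa using (PiLp.norm_apply_le (x - y) i).trans hxS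
      exact mul_le_mul (hb i) hi (abs_nonneg _) hM
    simpa using Finset.sum_le_sum this
  rw [hop]
  have h₁ := mul_le_mul_of_nonneg_left hquad (by positivity : 0 ≤ 4 * α ^ 2)
  have h₂ := mul_le_mul_of_nonneg_left htrace (by positivity : 0 ≤ 2 * α)
  have h₃ := mul_le_mul_of_nonneg_left hdrift (by positivity : 0 ≤ 2 * α)
  have h₄ := mul_nonneg hM hr
  have h₅ := mul_neg_of_pos_of_neg hEpos (by linarith :
    -(4 * α ^ 2 * ∑ i, ∑ j, a x i j * (x i - y i) * (x j - y j))
        + 2 * α * ∑ i, a x i i - 2 * α * ∑ i, b x i * (x i - y i) + M < 0)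
  linarith

end Operator

section StrongMaximumPrinciple

variable {k : ℕ} {Ω : Set (EuclideanSpace ℝ (Fin k))}
  {a : EuclideanSpace ℝ (Fin k) → Fin k → Fin k → ℝ}
  {b : EuclideanSpace ℝ (Fin k) → Fin k → ℝ} {M e : ℝ}
  {v : EuclideanSpace ℝ (Fin k) → ℝ}

/-- A nonnegative supersolution cannot have an isolated zero on the boundary sphere of a closed
ball on which it is otherwise positive. -/
theorem not_positive_on_punctured_closedBall (hΩ : IsOpen Ω) (hM : 0 ≤ M) (he : 0 < e)
    (ha : ∀ x ∈ Ω, ∀ i j, |a x i j| ≤ M) (hb : ∀ x ∈ Ω, ∀ i, |b x i| ≤ M)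
    (hsymm : ∀ x ∈ Ω, ∀ i j, a x i j = a x j i)
    (hell : ∀ x ∈ Ω, ∀ ξ : Fin k → ℝ,
      e * ∑ i, (ξ i) ^ 2 ≤ ∑ i, ∑ j, a x i j * ξ i * ξ j)
    (hv : ContDiffOn ℝ 2 v Ω) (hv_nonneg : ∀ x ∈ Ω, 0 ≤ v x)
    (hLv : ∀ x ∈ Ω, 0 ≤ secondOrderOp a b (fun _ => M) v x)
    {y z : EuclideanSpace ℝ (Fin k)} (hz : z ∈ Ω) (hzy : z ≠ y) (hvz : v z = 0) :
    ¬ ∀ x ∈ Ω, ‖x - y‖ ≤ ‖z - y‖ → x ≠ z → 0 < v x := by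
  intro hpos
  set R := ‖z - y‖ with hR
  have hRpos : 0 < R := norm_pos_iff.2 (sub_ne_zero.2 hzy)
  obtain ⟨ρ₀, hρ₀, hρ₀Ω⟩ := Metric.nhds_basis_closedBall.mem_iff.1 (hΩ.mem_nhds hz)
  set ρ := min ρ₀ (R / 2)
  have hρ : 0 < ρ := lt_min hρ₀ (half_pos hRpos)
  have hρR : ρ ≤ R / 2 := min_le_right _ _
  have hρΩ : Metric.closedBall z ρ ⊆ Ω :=
    (Metric.closedBall_subset_closedBall (min_le_left _ _)).trans hρ₀Ω
  obtain ⟨α, hα, hlarge⟩ : ∃ α : ℝ, 0 < α ∧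
      2 * α * (k * M) + 2 * α * (k * (M * (2 * R))) + M < 4 * α ^ 2 * (e * (R / 2) ^ 2) := by
    have hA : 0 < e * R ^ 2 := by positivity
    set B := 2 * (k * M) + 2 * (k * (M * (2 * R))) + M with hB
    have hBnn : 0 ≤ B := by positivity
    refine ⟨B / (e * R ^ 2) + 1, by positivity, ?_⟩
    set α := B / (e * R ^ 2) + 1 with hαdef
    have hα1 : 1 ≤ α := le_add_of_nonneg_left (by positivity)
    have hαA : α * (e * R ^ 2) = B + e * R ^ 2 := by
      rw [hαdef]
      field_simp
    calc 2 * α * (k * M) + 2 * α * (k * (M * (2 * R))) + M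
        ≤ α * B := by nlinarith [mul_le_mul_of_nonneg_right hα1 hM]
      _ < α * (B + e * R ^ 2) := by gcongr; linarith
      _ = 4 * α ^ 2 * (e * (R / 2) ^ 2) := by rw [← hαA]; ring
  set r := Real.exp (-α * R ^ 2)
  have hr : 0 < r := Real.exp_pos _
  set h : EuclideanSpace ℝ (Fin k) → ℝ := fun x => Real.exp (-α * ‖x - y‖ ^ 2) - r with hh
  have hhC : ContDiff ℝ 2 h :=
    ((contDiff_const.mul ((contDiff_id.sub contDiff_const).norm_sq ℝ)).exp).sub contDiff_const
  have hh_lt : ∀ x, h x < 1 := fun x => by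
    have : Real.exp (-α * ‖x - y‖ ^ 2) ≤ 1 := Real.exp_le_one_iff.2 (by
      rw [neg_mul]
      exact neg_nonpos.2 (by positivity))
    simp only [hh]
    linarith
  have hh_out : ∀ x, R < ‖x - y‖ → h x < 0 := fun x hx => by
    refine sub_neg.2 (Real.exp_lt_exp.2 ?_)
    rw [neg_mul, neg_mul]
    gcongr
  have hLh : ∀ x ∈ Metric.closedBall z ρ, secondOrderOp a b (fun _ => M) h x < 0 := by
    intro x hx
    have hxz : ‖x - z‖ ≤ ρ := by simpa [dist_eq_norm] using hx
    have h₁ : R ≤ ‖x - y‖ + ‖x - z‖ := by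
      simpa [hR, add_comm, norm_sub_rev x z] using norm_sub_le_norm_sub_add_norm_sub z x y
    have h₂ : ‖x - y‖ ≤ ‖x - z‖ + R := norm_sub_le_norm_sub_add_norm_sub x z y
    exact secondOrderOp_exp_barrier_neg hM he.le hα.le (by positivity) hr.le
      (fun i => ha x (hρΩ hx) i i) (hb x (hρΩ hx)) (hell x (hρΩ hx))
      (by linarith) (by linarith) hlarge
  have hK : IsCompact (Metric.sphere z ρ ∩ Metric.closedBall y R) :=
    (isCompact_sphere z ρ).inter_right Metric.isClosed_closedBall
  obtain ⟨m, hm, hmK⟩ := hK.exists_forall_le' (f := v) (a := 0)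
    (hv.continuousOn.mono (inter_subset_left.trans (Metric.sphere_subset_closedBall.trans hρΩ)))
    (fun x hx => hpos x (hρΩ (Metric.sphere_subset_closedBall hx.1))
      (by simpa [dist_eq_norm] using hx.2) (Metric.ne_of_mem_sphere hx.1 hρ.ne'))
  set g : EuclideanSpace ℝ (Fin k) → ℝ := fun x => 1 * v x + -(m / 2) * h x with hg
  have hg_sphere : ∀ x ∈ Metric.sphere z ρ, 0 < g x := by
    intro x hx
    have hxΩ := hρΩ (Metric.sphere_subset_closedBall hx)
    simp only [hg]
    rcases le_or_gt ‖x - y‖ R with hxR | hxR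
    · have h₁ := hmK x ⟨hx, by simpa [dist_eq_norm] using hxR⟩
      nlinarith [hh_lt x]
    · have h₁ := hh_out x hxR
      nlinarith [hv_nonneg x hxΩ]
  have hgz : g z = 0 := by simp [hg, hh, hvz, r, hR]
  obtain ⟨p, hp, hpmin⟩ := (isCompact_closedBall z ρ).exists_isMinOn
    ⟨z, Metric.mem_closedBall_self hρ.le⟩
    (((continuousOn_const.mul (hv.continuousOn.mono hρΩ)).add
      (continuousOn_const.mul hhC.continuous.continuousOn) : ContinuousOn g _))
  have hgp : g p ≤ 0 := hgz ▸ hpmin (Metric.mem_closedBall_self hρ.le)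
  have hp_ball : p ∈ Metric.ball z ρ := by
    rcases (Metric.mem_closedBall.1 hp).lt_or_eq with hlt | heq
    · exact hlt
    · exact absurd hgp (hg_sphere p heq).not_ge
  have hpΩ := hρΩ hp
  have hvp : ContDiffAt ℝ 2 v p := hv.contDiffAt (hΩ.mem_nhds hpΩ)
  have hgC : ContDiffAt ℝ 2 g p :=
    (contDiffAt_const.mul hvp).add (contDiffAt_const.mul hhC.contDiffAt)
  have hLg : secondOrderOp a b (fun _ => M) g p ≤ 0 :=
    secondOrderOp_nonpos_of_isLocalMin (hsymm p hpΩ)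
      (fun ξ => le_trans (by positivity) (hell p hpΩ ξ)) hM hgC
      (hpmin.isLocalMin (mem_of_superset (Metric.isOpen_ball.mem_nhds hp_ball)
        Metric.ball_subset_closedBall)) hgp
  rw [hg, secondOrderOp_linear_comb hvp hhC.contDiffAt] at hLg
  nlinarith [hLv p hpΩ, hLh p hp]

/-- The strong maximum principle: a nonnegative supersolution vanishing at an interior point of a
preconnected open set vanishes identically. -/
theorem eq_zero_of_supersolution (hΩ : IsOpen Ω) (hΩc : IsPreconnected Ω) (hM : 0 ≤ M)
    (he : 0 < e)
    (ha : ∀ x ∈ Ω, ∀ i j, |a x i j| ≤ M) (hb : ∀ x ∈ Ω, ∀ i, |b x i| ≤ M)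
    (hsymm : ∀ x ∈ Ω, ∀ i j, a x i j = a x j i)
    (hell : ∀ x ∈ Ω, ∀ ξ : Fin k → ℝ,
      e * ∑ i, (ξ i) ^ 2 ≤ ∑ i, ∑ j, a x i j * ξ i * ξ j)
    (hv : ContDiffOn ℝ 2 v Ω) (hv_nonneg : ∀ x ∈ Ω, 0 ≤ v x)
    (hLv : ∀ x ∈ Ω, 0 ≤ secondOrderOp a b (fun _ => M) v x)
    {x₀ : EuclideanSpace ℝ (Fin k)} (hx₀ : x₀ ∈ Ω) (hvx₀ : v x₀ = 0) :
    ∀ x ∈ Ω, v x = 0 := by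
  by_contra! hne
  obtain ⟨x₂, hx₂, hvx₂⟩ := hne
  have hU : IsOpen (Ω ∩ v ⁻¹' Ioi 0) := hv.continuousOn.isOpen_inter_preimage hΩ isOpen_Ioi
  refine absurd (hΩc.subset_of_closure_inter_subset hU
    ⟨x₂, hx₂, hx₂, (hv_nonneg x₂ hx₂).lt_of_ne' hvx₂⟩ ?_ hx₀).2 (by simp [hvx₀])
  rintro x₁ ⟨hx₁cl, hx₁⟩
  refine ⟨hx₁, ?_⟩
  by_contra hvx₁
  have hvx₁ : v x₁ = 0 := le_antisymm (not_lt.1 hvx₁) (hv_nonneg x₁ hx₁)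
  obtain ⟨s, hs, hsΩ⟩ := Metric.isOpen_iff.1 hΩ x₁ hx₁
  obtain ⟨y, ⟨-, hvy⟩, hys⟩ := Metric.mem_closure_iff.1 hx₁cl (s / 2) (half_pos hs)
  have hball : Metric.closedBall y (dist x₁ y) ⊆ Ω := fun x hx => hsΩ (by
    have h₁ := dist_triangle x y x₁
    rw [dist_comm y x₁] at h₁
    have h₂ := Metric.mem_closedBall.1 hx
    rw [Metric.mem_ball]
    linarith)
  have hZ : IsCompact (Metric.closedBall y (dist x₁ y) ∩ v ⁻¹' {0}) :=
    (isCompact_closedBall y _).of_isClosed_subset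
      ((hv.continuousOn.mono hball).preimage_isClosed_of_isClosed Metric.isClosed_closedBall
        isClosed_singleton) inter_subset_left
  obtain ⟨z, ⟨hzball, hvz⟩, hzmin⟩ := hZ.exists_isMinOn
    ⟨x₁, by simp, hvx₁⟩ (f := fun x => dist x y) (by fun_prop)
  have hpos : ∀ x, dist x y < dist z y → 0 < v x := by
    intro x hx
    have hxball : x ∈ Metric.closedBall y (dist x₁ y) := (hx.trans_le hzball).le
    refine (hv_nonneg x (hball hxball)).lt_of_ne' fun hvx => ?_
    exact (hzmin ⟨hxball, hvx⟩).not_gt hx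
  have hzy : z ≠ y := by
    rintro rfl
    exact (hvy : 0 < v z).ne' hvz
  set q := midpoint ℝ y z with hq
  have hzq : z ≠ q := by
    rw [hq, Ne, eq_comm, midpoint_eq_right_iff]
    exact hzy.symm
  refine not_positive_on_punctured_closedBall hΩ hM he ha hb hsymm hell hv hv_nonneg hLv
    (hball hzball) hzq hvz fun x _ hxq hxz => hpos x ?_
  rw [dist_eq_norm, dist_eq_norm]
  have hpar := parallelogram_law_with_norm ℝ (x - q) (z - q)
  have h₁ : x - q + (z - q) = x - y := by
    rw [hq, midpoint_eq_smul_add, invOf_eq_inv]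
    module
  have h₂ : x - q - (z - q) = x - z := by abel
  have h₃ : ‖z - q‖ = ‖z - y‖ / 2 := by
    have : z - q = (2⁻¹ : ℝ) • (z - y) := by
      rw [hq, midpoint_eq_smul_add, invOf_eq_inv]
      module
    rw [this, norm_smul]
    norm_num
    ring
  rw [h₁, h₂] at hpar
  have hxz' : 0 < ‖x - z‖ := norm_pos_iff.2 (sub_ne_zero.2 hxz)
  have hsq : ‖x - q‖ * ‖x - q‖ ≤ ‖z - q‖ * ‖z - q‖ := by gcongr
  rw [h₃] at hpar hsq
  refine lt_of_pow_lt_pow_left₀ 2 (norm_nonneg _) ?_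
  nlinarith [mul_pos hxz' hxz']

end StrongMaximumPrinciple

/-- Generalised maximum principle (Protter–Weinberger): if `D u ≥ 0`, `D w ≤ 0`,
`u > 0` on the closure, and `w/u` attains a non-negative maximum at an interior
point, then `w/u` is constant. -/
theorem generalized_maximum_principle {k : ℕ}
    (Ω : Set (EuclideanSpace ℝ (Fin k)))
    (hΩ_open : IsOpen Ω) (hΩ_bdd : Bornology.IsBounded Ω) (hΩ_conn : IsConnected Ω)
    (a : EuclideanSpace ℝ (Fin k) → Fin k → Fin k → ℝ)
    (b : EuclideanSpace ℝ (Fin k) → Fin k → ℝ)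
    (c : EuclideanSpace ℝ (Fin k) → ℝ)
    (ha_cont : ∀ i j, ContinuousOn (fun x => a x i j) Ω)
    (hb_cont : ∀ i, ContinuousOn (fun x => b x i) Ω)
    (hc_cont : ContinuousOn c Ω)
    (h_bdd : ∃ M : ℝ, ∀ x ∈ Ω,
      (∀ i j, |a x i j| ≤ M) ∧ (∀ i, |b x i| ≤ M) ∧ |c x| ≤ M)
    (ha_symm : ∀ x ∈ Ω, ∀ i j, a x i j = a x j i)
    (e : ℝ) (he : 0 < e)
    (h_ell : ∀ x ∈ Ω, ∀ ξ : Fin k → ℝ,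
      e * ∑ i, (ξ i) ^ 2 ≤ ∑ i, ∑ j, a x i j * ξ i * ξ j)
    (u w : EuclideanSpace ℝ (Fin k) → ℝ)
    (hu_cont : ContinuousOn u (closure Ω)) (hw_cont : ContinuousOn w (closure Ω))
    (hu_C2 : ContDiffOn ℝ 2 u Ω) (hw_C2 : ContDiffOn ℝ 2 w Ω)
    (hDu : ∀ x ∈ Ω, 0 ≤ secondOrderOp a b c u x)
    (hDw : ∀ x ∈ Ω, secondOrderOp a b c w x ≤ 0)
    (hu_pos : ∀ x ∈ closure Ω, 0 < u x)
    (x₀ : EuclideanSpace ℝ (Fin k)) (hx₀ : x₀ ∈ Ω)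
    (h_nonneg : 0 ≤ w x₀ / u x₀)
    (h_max : ∀ x ∈ Ω, w x / u x ≤ w x₀ / u x₀) :
    ∀ x ∈ Ω, w x / u x = w x₀ / u x₀ := by
  obtain ⟨M, hM⟩ := h_bdd
  have hM0 : 0 ≤ M := (abs_nonneg _).trans (hM x₀ hx₀).2.2
  set l := w x₀ / u x₀ with hl
  have hu : ∀ x ∈ Ω, 0 < u x := fun x hx => hu_pos x (subset_closure hx)
  have hv_nonneg : ∀ x ∈ Ω, 0 ≤ l * u x + -1 * w x := fun x hx => by
    have := (div_le_iff₀ (hu x hx)).1 (h_max x hx)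
    linarith
  have hLv : ∀ x ∈ Ω,
      0 ≤ secondOrderOp a b (fun _ => M) (fun x => l * u x + -1 * w x) x := by
    intro x hx
    have hcomb := secondOrderOp_linear_comb (a := a) (b := b) (c := c)
      (hu_C2.contDiffAt (hΩ_open.mem_nhds hx)) (hw_C2.contDiffAt (hΩ_open.mem_nhds hx)) l (-1)
    have hshift : secondOrderOp a b (fun _ => M) (fun x => l * u x + -1 * w x) x
        = secondOrderOp a b c (fun x => l * u x + -1 * w x) x
          + (M - c x) * (l * u x + -1 * w x) := by
      simp only [secondOrderOp]
      ring
    rw [hshift, hcomb]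
    have h₁ := mul_nonneg h_nonneg (hDu x hx)
    have h₂ := mul_nonneg (sub_nonneg.2 ((le_abs_self _).trans (hM x hx).2.2)) (hv_nonneg x hx)
    linarith [hDw x hx]
  have hzero := eq_zero_of_supersolution hΩ_open hΩ_conn.isPreconnected hM0 he
    (fun x hx => (hM x hx).1) (fun x hx => (hM x hx).2.1) ha_symm h_ell
    ((contDiffOn_const.mul hu_C2).add (contDiffOn_const.mul hw_C2)) hv_nonneg hLv hx₀
    (by rw [hl, div_mul_cancel₀ _ (hu x₀ hx₀).ne']; ring)
  intro x hx
  rw [div_eq_iff (hu x hx).ne']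
  linarith [hzero x hx]
end

section
/- Let d ≥ 1, let ψ : ℝ^d → ℝ be continuously differentiable and ℤ^d-periodic (ψ(x + n) = ψ(x) for all n ∈ ℤ^d), let Z := ψ^{-1}(0) be nonempty, and assume 0 is a regular value of ψ, i.e. ∇ψ(x) ≠ 0 for every x ∈ Z. Then there exists a constant c > 0 such that |ψ(x)| ≥ c · min(dist(x, Z), 1) for all x ∈ ℝ^d. -/
open Filter Topology in
/-- Near a regular zero of a continuous function, the distance to the zero set is controlled by the
absolute value of the function. -/
theorem HasStrictFDerivAt.exists_mul_infDist_zeros_le {E : Type*} [NormedAddCommGroup E]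
    [NormedSpace ℝ E] {f : E → ℝ} {f' : E →L[ℝ] ℝ} {x₀ : E} (hf : HasStrictFDerivAt f f' x₀)
    (hcont : Continuous f) (hx₀ : f x₀ = 0) (hf' : f' ≠ 0) :
    ∃ c > 0, ∀ᶠ x in 𝓝 x₀, c * Metric.infDist x (f ⁻¹' {0}) ≤ |f x| := by
  obtain ⟨w, hw⟩ : ∃ w, f' w ≠ 0 := by
    by_contra! h
    exact hf' (ContinuousLinearMap.ext h)
  obtain ⟨v, hv⟩ : ∃ v, f' v = 1 := ⟨(f' w)⁻¹ • w, by simp [hw]⟩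
  have hv0 : 0 ≤ ‖v‖ := norm_nonneg v
  refine ⟨1 / (2 * ‖v‖ + 1), by positivity, ?_⟩
  have hlim : Tendsto (fun x => (x + (-2 * f x) • v, x)) (𝓝 x₀) (𝓝 (x₀, x₀)) := by
    have h : Continuous fun x => (x + (-2 * f x) • v, x) := by fun_prop
    simpa [hx₀] using h.tendsto x₀
  have hsmall := hlim.eventually (hf.isLittleO.def (c := 1 / (2 * ‖v‖ + 1)) (by positivity))
  filter_upwards [hsmall] with x hx
  simp only [add_sub_cancel_left, map_smul, hv, smul_eq_mul, mul_one, norm_smul,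
    Real.norm_eq_abs, abs_mul, abs_neg, abs_two] at hx
  have hbound : |f (x + (-2 * f x) • v) - f x - -2 * f x| ≤ |f x| := by
    refine hx.trans ?_
    rw [one_div, inv_mul_le_iff₀ (by positivity)]
    nlinarith [abs_nonneg (f x)]
  have hzero : (0 : ℝ) ∈ Set.uIcc (f (x + (0 : ℝ) • v)) (f (x + (-2 * f x) • v)) := by
    rw [zero_smul, add_zero, Set.mem_uIcc]
    have := abs_le.1 hbound
    rcases le_total 0 (f x) with h | h
    · rw [abs_of_nonneg h] at this
      right; constructor <;> linarith
    · rw [abs_of_nonpos h] at this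
      left; constructor <;> linarith
  obtain ⟨s, hs, hsz⟩ := intermediate_value_uIcc
    (f := fun s : ℝ => f (x + s • v)) (by fun_prop) hzero
  have hs' : |s| ≤ 2 * |f x| := by
    simpa [abs_mul] using Set.abs_sub_left_of_mem_uIcc hs
  have hdist : Metric.infDist x (f ⁻¹' {0}) ≤ |s| * ‖v‖ := by
    simpa [norm_smul] using Metric.infDist_le_dist_of_mem (x := x) (s := f ⁻¹' {0}) hsz
  rw [one_div, inv_mul_le_iff₀ (by positivity)]
  nlinarith [abs_nonneg (f x)]

open Filter Topology in
/-- A `C¹` function with regular zero set is bounded below on every compact set by a multiple of the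
truncated distance to its zero set. -/
theorem IsCompact.exists_mul_min_infDist_zeros_le {E : Type*} [NormedAddCommGroup E]
    [NormedSpace ℝ E] {f : E → ℝ} (hf : ContDiff ℝ 1 f)
    (hreg : ∀ x, f x = 0 → fderiv ℝ f x ≠ 0) {K : Set E} (hK : IsCompact K) :
    ∃ c > 0, ∀ x ∈ K, c * min (Metric.infDist x (f ⁻¹' {0})) 1 ≤ |f x| := by
  have hmin (x : E) : 0 ≤ min (Metric.infDist x (f ⁻¹' {0})) 1 :=
    le_min Metric.infDist_nonneg zero_le_one
  refine hK.induction_on (p := fun S => ∃ c > 0, ∀ x ∈ S,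
    c * min (Metric.infDist x (f ⁻¹' {0})) 1 ≤ |f x|) ⟨1, one_pos, by simp⟩ ?_ ?_ ?_
  · rintro S T hST ⟨c, hc, h⟩
    exact ⟨c, hc, fun x hx => h x (hST hx)⟩
  · rintro S T ⟨c, hc, h⟩ ⟨c', hc', h'⟩
    refine ⟨min c c', lt_min hc hc', ?_⟩
    rintro x (hx | hx)
    · exact (mul_le_mul_of_nonneg_right (min_le_left _ _) (hmin x)).trans (h x hx)
    · exact (mul_le_mul_of_nonneg_right (min_le_right _ _) (hmin x)).trans (h' x hx)
  · intro x₀ _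
    by_cases hx₀ : f x₀ = 0
    · obtain ⟨c, hc, h⟩ := (hf.contDiffAt.hasStrictFDerivAt one_ne_zero
        ).exists_mul_infDist_zeros_le hf.continuous hx₀ (hreg x₀ hx₀)
      exact ⟨_, mem_nhdsWithin_of_mem_nhds h, c, hc, fun x hx =>
        (mul_le_mul_of_nonneg_left (min_le_left _ _) hc.le).trans hx⟩
    · have hpos : 0 < |f x₀| := abs_pos.2 hx₀
      have h : ∀ᶠ x in 𝓝 x₀, |f x₀| / 2 < |f x| :=
        hf.continuous.abs.continuousAt.eventually_const_lt (half_lt_self hpos)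
      refine ⟨_, mem_nhdsWithin_of_mem_nhds h, |f x₀| / 2, half_pos hpos, fun x hx => ?_⟩
      have hx : |f x₀| / 2 < |f x| := hx
      nlinarith [min_le_right (Metric.infDist x (f ⁻¹' {0})) 1]

/-- Quantitative nondegeneracy of a periodic `C¹` function near its regular zero set:
`|ψ(x)| ≥ c · min(dist(x, Z), 1)` for some `c > 0`. -/
theorem regular_zero_set_lower_bound (d : ℕ) (hd : 1 ≤ d)
    (ψ : EuclideanSpace ℝ (Fin d) → ℝ) (hψ : ContDiff ℝ 1 ψ)
    (hper : ∀ (x : EuclideanSpace ℝ (Fin d)) (n : Fin d → ℤ),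
      ψ (x + (EuclideanSpace.equiv (Fin d) ℝ).symm (fun i => (n i : ℝ))) = ψ x)
    (hZ : (ψ ⁻¹' {0}).Nonempty)
    (hreg : ∀ x, ψ x = 0 → fderiv ℝ ψ x ≠ 0) :
    ∃ c > 0, ∀ x, c * min (Metric.infDist x (ψ ⁻¹' {0})) 1 ≤ |ψ x| := by
  have hK : IsCompact ((EuclideanSpace.equiv (Fin d) ℝ).symm '' Set.Icc 0 1) :=
    isCompact_Icc.image (EuclideanSpace.equiv (Fin d) ℝ).symm.continuous
  obtain ⟨c, hc, h⟩ := hK.exists_mul_min_infDist_zeros_le hψ hreg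
  refine ⟨c, hc, fun x => ?_⟩
  set y := (EuclideanSpace.equiv (Fin d) ℝ).symm fun i => Int.fract (x i) with hy
  set n := (EuclideanSpace.equiv (Fin d) ℝ).symm fun i => (⌊x i⌋ : ℝ) with hn
  have hxy : x = y + n := by
    ext i
    simp [hy, hn]
  have hyK := h y ⟨_, ⟨fun i => Int.fract_nonneg _, fun i => (Int.fract_lt_one _).le⟩, rfl⟩
  have hψxy : ψ x = ψ y := by
    rw [hxy]
    exact hper y _
  have hdist : Metric.infDist x (ψ ⁻¹' {0}) ≤ Metric.infDist y (ψ ⁻¹' {0}) := by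
    refine (Metric.le_infDist hZ).2 fun z hz => ?_
    have hzn : z + n ∈ ψ ⁻¹' {0} := (hper z _).trans hz
    calc Metric.infDist x (ψ ⁻¹' {0}) ≤ dist x (z + n) := Metric.infDist_le_dist_of_mem hzn
      _ = dist y z := by rw [hxy, dist_add_right]
  rw [hψxy]
  exact (mul_le_mul_of_nonneg_left (min_le_min_right 1 hdist) hc.le).trans hyK
end

section
/- Define θ₁(ε) = 1, θ₂(ε) = (log(1/ε))^{1/2}, θ₃(ε) = ε^{-1/2}. For each d ∈ {1,2,3} there exists a constant C such that for every ε ∈ (0, 1/2), every Lebesgue-measurable set Ω ⊆ ℝ^d of Lebesgue measure at most ε^d, and every compactly supported continuously differentiable function f : ℝ^d → ℝ, one has ∫_Ω f² dx ≤ C θ_d(ε)² ε^d ∫_{ℝ^d} (f² + |∇f|²) dx. -/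
open MeasureTheory

/-- The convergence rates `θ₁(ε) = 1`, `θ₂(ε) = √(log(1/ε))`, `θ₃(ε) = ε^{-1/2}`. -/
noncomputable def theta (d : ℕ) (ε : ℝ) : ℝ :=
  if d = 1 then 1
  else if d = 2 then Real.sqrt (Real.log (1 / ε))
  else ε ^ (-(1 / 2 : ℝ))

section Plancherel

open scoped FourierTransform SchwartzMap InnerProductSpace

variable {V : Type*} [NormedAddCommGroup V] [InnerProductSpace ℝ V] [FiniteDimensional ℝ V]
  [MeasurableSpace V] [BorelSpace V]

theorem continuous_fourier_of_integrable {h : V → ℂ} (h1 : Integrable h) : Continuous (𝓕 h) :=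
  VectorFourier.fourierIntegral_continuous Real.continuous_fourierChar
    (by exact continuous_inner) h1

/-- The Fourier transform on `L²` agrees with the integral formula on `L¹ ∩ L²`. -/
theorem Lp_fourier_ae_eq {h : V → ℂ} (h1 : Integrable h) (h2 : MemLp h 2) :
    (𝓕 (h2.toLp h) : Lp ℂ 2 (volume : Measure V)) =ᵐ[volume] 𝓕 h := by
  refine ae_eq_of_integral_contDiff_smul_eq ((Lp.memLp _).locallyIntegrable one_le_two)
    (continuous_fourier_of_integrable h1).locallyIntegrable fun g hg hgs ↦ ?_
  have hgs' : HasCompactSupport (fun x ↦ (g x : ℂ)) := hgs.comp_left (g := Complex.ofReal) rfl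
  have hg' : ContDiff ℝ (⊤ : ℕ∞) (fun x ↦ (g x : ℂ)) := Complex.ofRealCLM.contDiff.comp hg
  let φ : 𝓢(V, ℂ) := hgs'.toSchwartzMap hg'
  have hφ (x : V) : φ x = (g x : ℂ) := rfl
  have key := congrArg (fun T ↦ T φ) (Lp.fourier_toTemperedDistribution_eq (h2.toLp h))
  simp only [TemperedDistribution.fourier_apply, Lp.toTemperedDistribution_apply] at key
  have hflip : ∫ ξ, 𝓕 (φ : V → ℂ) ξ • h ξ = ∫ x, φ x • 𝓕 h x := by
    have := VectorFourier.integral_fourierIntegral_smul_eq_flip (μ := (volume : Measure V))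
      (ν := (volume : Measure V)) (L := innerₗ V) (f := (φ : V → ℂ)) (g := h)
      Real.continuous_fourierChar (by exact continuous_inner) φ.integrable h1
    rw [flip_innerₗ] at this
    exact this
  calc ∫ x, g x • (𝓕 (h2.toLp h) : Lp ℂ 2 (volume : Measure V)) x
      = ∫ x, φ x • (𝓕 (h2.toLp h) : Lp ℂ 2 (volume : Measure V)) x := by simp [hφ]
    _ = ∫ x, (𝓕 φ) x • (h2.toLp h) x := key.symm
    _ = ∫ x, 𝓕 (φ : V → ℂ) x • h x := by
      refine integral_congr_ae ?_
      filter_upwards [h2.coeFn_toLp] with x hx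
      rw [hx, SchwartzMap.fourier_coe]
    _ = _ := by rw [hflip]; simp [hφ]

theorem memLp_fourier {h : V → ℂ} (h1 : Integrable h) (h2 : MemLp h 2) : MemLp (𝓕 h) 2 :=
  (memLp_congr_ae (Lp_fourier_ae_eq h1 h2)).1 (Lp.memLp _)

/-- Parseval's identity on `L¹ ∩ L²`. -/
theorem integral_inner_fourier {h k : V → ℂ} (h1 : Integrable h) (h2 : MemLp h 2)
    (k1 : Integrable k) (k2 : MemLp k 2) :
    ∫ ξ, ⟪𝓕 h ξ, 𝓕 k ξ⟫_ℂ = ∫ x, ⟪h x, k x⟫_ℂ := by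
  have := Lp.inner_fourier_eq (h2.toLp h) (k2.toLp k)
  rw [L2.inner_def, L2.inner_def] at this
  calc _ = _ := integral_congr_ae (by
        filter_upwards [Lp_fourier_ae_eq h1 h2, Lp_fourier_ae_eq k1 k2] with x hx hy
        rw [hx, hy])
    _ = _ := this
    _ = _ := integral_congr_ae (by
        filter_upwards [h2.coeFn_toLp, k2.coeFn_toLp] with x hx hy
        rw [hx, hy])

/-- Plancherel's identity on `L¹ ∩ L²`. -/
theorem integral_norm_fourier_sq {h : V → ℂ} (h1 : Integrable h) (h2 : MemLp h 2) :
    ∫ ξ, ‖𝓕 h ξ‖ ^ 2 = ∫ x, ‖h x‖ ^ 2 := by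
  have := integral_inner_fourier h1 h2 h1 h2
  simp only [inner_self_eq_norm_sq_to_K] at this
  norm_cast at this

omit [MeasurableSpace V] [BorelSpace V] in
theorem sum_sq_apply_orthonormalBasis {ι : Type*} [Fintype ι]
    (b : OrthonormalBasis ι ℝ V) (L : V →L[ℝ] ℝ) :
    ∑ i, (L (b i)) ^ 2 = ‖L‖ ^ 2 := by
  obtain ⟨v, rfl⟩ := (InnerProductSpace.toDual ℝ V).surjective L
  rw [LinearIsometryEquiv.norm_map, ← b.sum_sq_norm_inner_left v]
  simp

theorem integral_norm_sq_mul_fourier_sq {f : V → ℝ} (hf : ContDiff ℝ 1 f)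
    (hs : HasCompactSupport f) :
    Integrable (fun ξ ↦ (2 * Real.pi * ‖ξ‖) ^ 2 * ‖𝓕 (fun x ↦ (f x : ℂ)) ξ‖ ^ 2) ∧
    ∫ ξ, (2 * Real.pi * ‖ξ‖) ^ 2 * ‖𝓕 (fun x ↦ (f x : ℂ)) ξ‖ ^ 2 = ∫ x, ‖fderiv ℝ f x‖ ^ 2 := by
  set F : V → ℂ := fun x ↦ (f x : ℂ) with hF
  have hFc : ContDiff ℝ 1 F := Complex.ofRealCLM.contDiff.comp hf
  have hFs : HasCompactSupport F := hs.comp_left (g := Complex.ofReal) rfl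
  have hF1 : Integrable F := hFc.continuous.integrable_of_hasCompactSupport hFs
  have hdc : Continuous (fderiv ℝ F) := hFc.continuous_fderiv (by simp)
  have hds : HasCompactSupport (fderiv ℝ F) := hFs.fderiv (𝕜 := ℝ)
  have hd1 : Integrable (fderiv ℝ F) := hdc.integrable_of_hasCompactSupport hds
  have hdF (x v : V) : fderiv ℝ F x v = ((fderiv ℝ f x v : ℝ) : ℂ) := by
    have : HasFDerivAt F (Complex.ofRealCLM.comp (fderiv ℝ f x)) x :=
      Complex.ofRealCLM.hasFDerivAt.comp x (hf.differentiable (by simp) x).hasFDerivAt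
    rw [this.fderiv]; rfl
  let b := stdOrthonormalBasis ℝ V
  have hic (i) : Continuous fun x ↦ fderiv ℝ F x (b i) := hdc.clm_apply continuous_const
  have his (i) : HasCompactSupport fun x ↦ fderiv ℝ F x (b i) :=
    hds.comp_left (g := fun L : V →L[ℝ] ℂ ↦ L (b i)) rfl
  have hi1 (i) : Integrable fun x ↦ fderiv ℝ F x (b i) :=
    (hic i).integrable_of_hasCompactSupport (his i)
  have hi2 (i) : MemLp (fun x ↦ fderiv ℝ F x (b i)) 2 :=
    (hic i).memLp_of_hasCompactSupport (his i)
  have hfour (i) (ξ : V) : ‖𝓕 (fun x ↦ fderiv ℝ F x (b i)) ξ‖ ^ 2 =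
      (2 * Real.pi * inner ℝ ξ (b i)) ^ 2 * ‖𝓕 F ξ‖ ^ 2 := by
    rw [← Real.fourier_continuousLinearMap_apply hd1, Real.fourier_fderiv hF1
      (hFc.differentiable (by simp)) hd1, VectorFourier.fourierSMulRight_apply]
    rw [neg_apply, neg_apply, innerSL_apply_apply]
    simp [mul_pow]
    ring
  have hsum (ξ : V) : (2 * Real.pi * ‖ξ‖) ^ 2 * ‖𝓕 F ξ‖ ^ 2 =
      ∑ i, ‖𝓕 (fun x ↦ fderiv ℝ F x (b i)) ξ‖ ^ 2 := by
    simp_rw [hfour, ← Finset.sum_mul, mul_pow (2 * Real.pi), ← Finset.mul_sum]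
    rw [← b.sum_sq_norm_inner_left ξ]
    simp
  have hDi (i) : Integrable fun ξ ↦ ‖𝓕 (fun x ↦ fderiv ℝ F x (b i)) ξ‖ ^ 2 :=
    (memLp_fourier (hi1 i) (hi2 i)).integrable_norm_pow (by simp)
  simp_rw [hsum]
  refine ⟨integrable_finsetSum _ fun i _ ↦ hDi i, ?_⟩
  rw [integral_finsetSum _ fun i _ ↦ hDi i]
  simp_rw [fun i ↦ integral_norm_fourier_sq (hi1 i) (hi2 i)]
  rw [← integral_finsetSum _ fun i _ ↦ (hi2 i).integrable_norm_pow (by simp)]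
  congr with x
  simp only [hdF]
  rw [← sum_sq_apply_orthonormalBasis b]
  simp

/-- Cauchy-Schwarz against the indicator of a set of measure at most `m`. -/
theorem sq_setIntegral_abs_le {X : Type*} [MeasurableSpace X] {μ : Measure X} {Ω : Set X}
    {m : ℝ} (hm : 0 ≤ m) (hΩ : μ Ω ≤ ENNReal.ofReal m) {f : X → ℝ}
    (h1 : IntegrableOn f Ω μ) (h2 : IntegrableOn (fun x ↦ f x ^ 2) Ω μ) :
    (∫ x in Ω, |f x| ∂μ) ^ 2 ≤ m * ∫ x in Ω, f x ^ 2 ∂μ := by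
  have hfin : μ Ω ≠ ⊤ := ne_top_of_le_ne_top ENNReal.ofReal_ne_top hΩ
  have hreal : μ.real Ω ≤ m := ENNReal.toReal_le_of_le_ofReal hm hΩ
  have hquad (c : ℝ) : 0 ≤ m * (c * c) + (-2 * ∫ x in Ω, |f x| ∂μ) * c +
      ∫ x in Ω, f x ^ 2 ∂μ := by
    have hc : IntegrableOn (fun _ : X ↦ c ^ 2) Ω μ := integrableOn_const hfin
    have h0 : 0 ≤ ∫ x in Ω, (f x ^ 2 - 2 * c * |f x| + c ^ 2) ∂μ :=
      integral_nonneg fun x ↦ by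
        have := sq_nonneg (|f x| - c)
        have := sq_abs (f x)
        simp only [Pi.zero_apply]
        linarith
    have hsub : Integrable (fun x ↦ f x ^ 2 - 2 * c * |f x|) (μ.restrict Ω) :=
      h2.sub (h1.abs.const_mul _)
    rw [integral_add hsub hc,
      integral_sub h2 (h1.abs.const_mul _),
      integral_const_mul, setIntegral_const, smul_eq_mul] at h0
    have := mul_le_mul_of_nonneg_right hreal (sq_nonneg c)
    linarith
  have := discrim_le_zero hquad
  rw [discrim] at this
  linarith

theorem setIntegral_sq_le_of_volume_le {f : V → ℝ} (hf : ContDiff ℝ 1 f)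
    (hs : HasCompactSupport f) {Ω : Set V} (hΩm : MeasurableSet Ω) {m ε K : ℝ} (hm : 0 < m)
    (hε : 0 < ε) (hΩ : volume Ω ≤ ENNReal.ofReal m)
    (hK : ∫ ξ in Metric.ball (0 : V) ε⁻¹, (1 + ‖ξ‖ ^ 2)⁻¹ ≤ K) (hK0 : 0 < K) :
    ∫ x in Ω, f x ^ 2 ≤ 2 * (m * K + ε ^ 2) * ∫ x, (f x ^ 2 + ‖fderiv ℝ f x‖ ^ 2) := by
  set I := ∫ x in Ω, f x ^ 2 with hI
  set N := ∫ x, (f x ^ 2 + ‖fderiv ℝ f x‖ ^ 2) with hN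
  let F : V → ℂ := fun x ↦ (f x : ℂ)
  let G : V → ℂ := Ω.indicator F
  let B : Set V := Metric.ball (0 : V) ε⁻¹
  have hFc : Continuous F := Complex.continuous_ofReal.comp hf.continuous
  have hFs : HasCompactSupport F := hs.comp_left (g := Complex.ofReal) rfl
  have hF1 : Integrable F := hFc.integrable_of_hasCompactSupport hFs
  have hF2 : MemLp F 2 := hFc.memLp_of_hasCompactSupport hFs
  have hG1 : Integrable G := hF1.indicator hΩm
  have hG2 : MemLp G 2 := hF2.indicator hΩm
  have hf1 : Integrable f := hf.continuous.integrable_of_hasCompactSupport hs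
  have hf2 : Integrable (fun x ↦ f x ^ 2) :=
    (hf.continuous.memLp_of_hasCompactSupport (p := 2) hs).integrable_sq
  have hd2 : Integrable (fun x ↦ ‖fderiv ℝ f x‖ ^ 2) :=
    ((hf.continuous_fderiv (by simp)).memLp_of_hasCompactSupport (p := 2)
      (hs.fderiv (𝕜 := ℝ))).integrable_norm_pow (by simp)
  have hI0 : 0 ≤ I := integral_nonneg fun x ↦ sq_nonneg _
  obtain ⟨hgi, hge⟩ := integral_norm_sq_mul_fourier_sq hf hs
  have hFi : Integrable fun ξ ↦ ‖𝓕 F ξ‖ ^ 2 :=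
    (memLp_fourier hF1 hF2).integrable_norm_pow (by simp)
  have hGi : Integrable fun ξ ↦ ‖𝓕 G ξ‖ ^ 2 :=
    (memLp_fourier hG1 hG2).integrable_norm_pow (by simp)
  have hG2I : ∫ ξ, ‖𝓕 G ξ‖ ^ 2 = I := by
    rw [integral_norm_fourier_sq hG1 hG2, hI, ← integral_indicator hΩm]
    congr with x
    by_cases hx : x ∈ Ω <;> simp [G, F, hx]
  have hFGi : Integrable fun ξ ↦ ‖𝓕 F ξ‖ * ‖𝓕 G ξ‖ :=
    (memLp_fourier hF1 hF2).norm.integrable_mul (memLp_fourier hG1 hG2).norm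
  have hFG : I ≤ ∫ ξ, ‖𝓕 F ξ‖ * ‖𝓕 G ξ‖ := by
    have h : ∫ x, ⟪F x, G x⟫_ℂ = (I : ℂ) := by
      rw [hI, ← integral_indicator hΩm, ← integral_complex_ofReal]
      congr with x
      by_cases hx : x ∈ Ω
      · simp only [G, F, hx, Set.indicator_of_mem, RCLike.inner_apply, Complex.conj_ofReal]
        push_cast
        ring
      · simp [G, hx]
    calc I = ‖∫ ξ, ⟪𝓕 F ξ, 𝓕 G ξ⟫_ℂ‖ := by
          rw [integral_inner_fourier hF1 hF2 hG1 hG2, h, Complex.norm_real,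
            Real.norm_of_nonneg hI0]
      _ ≤ ∫ ξ, ‖⟪𝓕 F ξ, 𝓕 G ξ⟫_ℂ‖ := norm_integral_le_integral_norm _
      _ ≤ _ := integral_mono_of_nonneg (.of_forall fun _ ↦ norm_nonneg _) hFGi
        (.of_forall fun ξ ↦ norm_inner_le_norm _ _)
  have hGsup (ξ : V) : ‖𝓕 G ξ‖ ^ 2 ≤ m * I := by
    refine le_trans ?_ (sq_setIntegral_abs_le hm.le hΩ hf1.integrableOn hf2.integrableOn)
    gcongr
    refine (VectorFourier.norm_fourierIntegral_le_integral_norm _ _ _ _ _).trans_eq ?_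
    rw [← integral_indicator hΩm]
    congr with x
    by_cases hx : x ∈ Ω <;> simp [G, F, hx]
  have hw (ξ : V) : 0 < 1 + ‖ξ‖ ^ 2 := by positivity
  have hwi : Integrable fun ξ ↦ (1 + ‖ξ‖ ^ 2) * ‖𝓕 F ξ‖ ^ 2 := by
    refine (hFi.add (hgi.const_mul ((2 * Real.pi) ^ 2)⁻¹)).congr (.of_forall fun ξ ↦ ?_)
    simp only [Pi.add_apply, F]
    field_simp
  have hwN : ∫ ξ, (1 + ‖ξ‖ ^ 2) * ‖𝓕 F ξ‖ ^ 2 ≤ N := by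
    calc _ ≤ ∫ ξ, (‖𝓕 F ξ‖ ^ 2 + (2 * Real.pi * ‖ξ‖) ^ 2 * ‖𝓕 F ξ‖ ^ 2) := by
          refine integral_mono hwi (hFi.add hgi) fun ξ ↦ ?_
          have : 1 ≤ (2 * Real.pi) ^ 2 := by nlinarith [Real.pi_gt_three]
          have := mul_le_mul_of_nonneg_right this (by positivity : 0 ≤ ‖ξ‖ ^ 2 * ‖𝓕 F ξ‖ ^ 2)
          simp only
          linarith
      _ = N := by
          rw [integral_add hFi hgi, integral_norm_fourier_sq hF1 hF2, hge, hN,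
            integral_add hf2 hd2]
          simp [F]
  have hcw : Continuous fun ξ : V ↦ (1 + ‖ξ‖ ^ 2)⁻¹ :=
    Continuous.inv₀ (by fun_prop) fun ξ ↦ (hw ξ).ne'
  have hBi : Integrable (B.indicator fun ξ : V ↦ (1 + ‖ξ‖ ^ 2)⁻¹) :=
    (integrable_indicator_iff measurableSet_ball).2 <|
      (hcw.continuousOn.integrableOn_compact (isCompact_closedBall 0 ε⁻¹)).mono_set
        Metric.ball_subset_closedBall
  -- Below the frequency `ε⁻¹` the sup bound on `𝓕 G` is used, above it the weight `1 + ‖ξ‖ ^ 2`.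
  have hpt (ξ : V) : ‖𝓕 F ξ‖ * ‖𝓕 G ξ‖ ≤ (m * K + ε ^ 2) * ((1 + ‖ξ‖ ^ 2) * ‖𝓕 F ξ‖ ^ 2) +
      4⁻¹ * (‖𝓕 G ξ‖ ^ 2 + I / K * B.indicator (fun ξ ↦ (1 + ‖ξ‖ ^ 2)⁻¹) ξ) := by
    by_cases hξ : ξ ∈ B
    · rw [Set.indicator_of_mem hξ]
      have hwξ := hw ξ
      have hp : 0 < m * K * (1 + ‖ξ‖ ^ 2) := by positivity
      have h1 : ‖𝓕 F ξ‖ * ‖𝓕 G ξ‖ ≤ m * K * (1 + ‖ξ‖ ^ 2) * ‖𝓕 F ξ‖ ^ 2 +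
          ‖𝓕 G ξ‖ ^ 2 / (4 * (m * K * (1 + ‖ξ‖ ^ 2))) := by
        have := div_nonneg (sq_nonneg (2 * (m * K * (1 + ‖ξ‖ ^ 2)) * ‖𝓕 F ξ‖ - ‖𝓕 G ξ‖))
          (by positivity : 0 ≤ 4 * (m * K * (1 + ‖ξ‖ ^ 2)))
        refine sub_nonneg.1 (this.trans_eq ?_)
        field_simp
        ring
      have h2 : ‖𝓕 G ξ‖ ^ 2 / (4 * (m * K * (1 + ‖ξ‖ ^ 2))) ≤
          4⁻¹ * (I / K * (1 + ‖ξ‖ ^ 2)⁻¹) := by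
        calc _ ≤ m * I / (4 * (m * K * (1 + ‖ξ‖ ^ 2))) := by gcongr; exact hGsup ξ
          _ = _ := by field_simp
      have h3 : 0 ≤ ε ^ 2 * ((1 + ‖ξ‖ ^ 2) * ‖𝓕 F ξ‖ ^ 2) := by positivity
      linarith [sq_nonneg ‖𝓕 G ξ‖]
    · rw [Set.indicator_of_notMem hξ]
      have h1 : 1 ≤ ε ^ 2 * (1 + ‖ξ‖ ^ 2) := by
        have : ε⁻¹ ≤ ‖ξ‖ := by simpa [B] using hξ
        have : 1 ≤ ε * ‖ξ‖ := by rwa [inv_le_iff_one_le_mul₀' hε] at this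
        nlinarith [sq_nonneg ε]
      have h2 := mul_le_mul_of_nonneg_right h1 (sq_nonneg ‖𝓕 F ξ‖)
      have h3 : 0 ≤ m * K * ((1 + ‖ξ‖ ^ 2) * ‖𝓕 F ξ‖ ^ 2) := by positivity
      linarith [sq_nonneg (‖𝓕 F ξ‖ - ‖𝓕 G ξ‖ / 2)]
  have hmain : I ≤ (m * K + ε ^ 2) * N + 4⁻¹ * (I + I / K * K) := by
    have hrest : Integrable fun ξ ↦
        4⁻¹ * (‖𝓕 G ξ‖ ^ 2 + I / K * B.indicator (fun ξ ↦ (1 + ‖ξ‖ ^ 2)⁻¹) ξ) :=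
      (hGi.add (hBi.const_mul _)).const_mul _
    refine hFG.trans ((integral_mono hFGi ((hwi.const_mul _).add hrest) hpt).trans ?_)
    rw [integral_add' (hwi.const_mul _) hrest, integral_const_mul, integral_const_mul,
      integral_add hGi (hBi.const_mul _), hG2I, integral_const_mul,
      integral_indicator measurableSet_ball]
    gcongr
  rw [div_mul_cancel₀ _ hK0.ne'] at hmain
  linarith

end Plancherel

theorem integral_ball_inv_one_add_norm_sq {d : ℕ} (hd : d ≠ 0) {R : ℝ} (hR : 0 < R) :
    ∫ ξ in Metric.ball (0 : EuclideanSpace ℝ (Fin d)) R, (1 + ‖ξ‖ ^ 2)⁻¹ =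
      d * volume.real (Metric.ball (0 : EuclideanSpace ℝ (Fin d)) 1) *
        ∫ y in (0 : ℝ)..R, y ^ (d - 1) * (1 + y ^ 2)⁻¹ := by
  have : Nonempty (Fin d) := Fin.pos_iff_nonempty.1 (Nat.pos_of_ne_zero hd)
  have h := integral_fun_norm_addHaar (volume : Measure (EuclideanSpace ℝ (Fin d)))
    ((Set.Iio R).indicator fun y : ℝ ↦ (1 + y ^ 2)⁻¹)
  rw [finrank_euclideanSpace_fin, nsmul_eq_mul, smul_eq_mul, ← mul_assoc] at h
  rw [← integral_indicator measurableSet_ball, intervalIntegral.integral_of_le hR.le,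
    integral_Ioc_eq_integral_Ioo]
  convert h using 2
  · ext ξ
    simp [Set.indicator]
  · rw [← Set.Ioi_inter_Iio, ← setIntegral_indicator measurableSet_Iio]
    congr with y
    simp [Set.indicator]

theorem theta_one (ε : ℝ) : theta 1 ε = 1 := by simp [theta]

theorem theta_two_sq {ε : ℝ} (h0 : 0 < ε) (h1 : ε ≤ 1) : theta 2 ε ^ 2 = Real.log ε⁻¹ := by
  simp only [theta, one_div]
  exact Real.sq_sqrt (Real.log_nonneg ((one_le_inv₀ h0).2 h1))

theorem theta_three_sq {ε : ℝ} (h0 : 0 < ε) : theta 3 ε ^ 2 = ε⁻¹ := by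
  simp only [theta]
  norm_num
  rw [← Real.rpow_natCast, ← Real.rpow_mul h0.le]
  norm_num [Real.rpow_neg_one]

theorem intervalIntegral_le_theta_sq {d : ℕ} (hd : d = 1 ∨ d = 2 ∨ d = 3) {ε : ℝ} (h0 : 0 < ε)
    (h1 : ε < 1 / 2) :
    ∫ y in (0 : ℝ)..ε⁻¹, y ^ (d - 1) * (1 + y ^ 2)⁻¹ ≤ 2 * theta d ε ^ 2 := by
  have hR : 2 < ε⁻¹ := by rw [lt_inv_comm₀ two_pos h0]; linarith
  have hw (y : ℝ) : 0 < 1 + y ^ 2 := by positivity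
  have hcw : Continuous fun y : ℝ ↦ (1 + y ^ 2)⁻¹ :=
    Continuous.inv₀ (by fun_prop) fun y ↦ (hw y).ne'
  rcases hd with rfl | rfl | rfl
  · simp only [theta_one, tsub_self, pow_zero, one_mul, integral_inv_one_add_sq]
    have := Real.arctan_lt_pi_div_two ε⁻¹
    have := Real.pi_lt_four
    norm_num
    linarith
  · rw [theta_two_sq h0 (by linarith)]
    have hder (y : ℝ) : HasDerivAt (fun y ↦ 2⁻¹ * Real.log (1 + y ^ 2))
        (y ^ (2 - 1) * (1 + y ^ 2)⁻¹) y := by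
      convert! ((((hasDerivAt_id y).pow 2).const_add 1).log (hw y).ne').const_mul 2⁻¹ using 1
      simp
      field_simp
    rw [intervalIntegral.integral_eq_sub_of_hasDerivAt (fun y _ ↦ hder y)
      (((continuous_pow _).mul hcw).intervalIntegrable _ _)]
    have : Real.log (1 + ε⁻¹ ^ 2) ≤ Real.log (ε⁻¹ ^ 4) :=
      Real.log_le_log (hw _) (by
        have : 4 ≤ ε⁻¹ ^ 2 := by nlinarith
        nlinarith)
    rw [Real.log_pow] at this
    norm_num at this ⊢
    linarith
  · rw [theta_three_sq h0]
    have : ∫ y in (0 : ℝ)..ε⁻¹, y ^ (3 - 1) * (1 + y ^ 2)⁻¹ ≤ ∫ y in (0 : ℝ)..ε⁻¹, (1 : ℝ) := by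
      refine intervalIntegral.integral_mono_on (by linarith)
        (((continuous_pow _).mul hcw).intervalIntegrable _ _) (by simp) fun y _ ↦ ?_
      rw [← div_eq_mul_inv, div_le_one (hw y)]
      simp
    rw [intervalIntegral.integral_const] at this
    simp only [sub_zero, smul_eq_mul, mul_one] at this
    linarith

theorem sq_le_theta_sq_mul_pow {d : ℕ} (hd : d = 1 ∨ d = 2 ∨ d = 3) {ε : ℝ} (h0 : 0 < ε)
    (h1 : ε < 1 / 2) : ε ^ 2 ≤ 2 * theta d ε ^ 2 * ε ^ d := by
  rcases hd with rfl | rfl | rfl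
  · rw [theta_one]
    nlinarith
  · rw [theta_two_sq h0 (by linarith)]
    have hR : 2 ≤ ε⁻¹ := by rw [le_inv_comm₀ two_pos h0]; linarith
    have : Real.log 2 ≤ Real.log ε⁻¹ := Real.log_le_log two_pos hR
    have := Real.log_two_gt_d9
    exact le_mul_of_one_le_left (sq_nonneg ε) (by linarith)
  · rw [theta_three_sq h0]
    field_simp
    norm_num

/-- Dimension-dependent Sobolev-type estimate: for `d ∈ {1,2,3}` the `L²`-mass of a
`W¹`-function on a set of measure at most `ε^d` is bounded by
`C θ_d(ε)² ε^d` times its `W¹`-norm squared. -/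
theorem small_set_sobolev_estimate (d : ℕ) (hd : d = 1 ∨ d = 2 ∨ d = 3) :
    ∃ C : ℝ, ∀ ε ∈ Set.Ioo (0 : ℝ) (1 / 2),
      ∀ Ω : Set (EuclideanSpace ℝ (Fin d)), MeasurableSet Ω →
        volume Ω ≤ ENNReal.ofReal (ε ^ d) →
      ∀ f : EuclideanSpace ℝ (Fin d) → ℝ, ContDiff ℝ 1 f → HasCompactSupport f →
        ∫ x in Ω, (f x) ^ 2 ≤
          C * (theta d ε) ^ 2 * ε ^ d * ∫ x, ((f x) ^ 2 + ‖fderiv ℝ f x‖ ^ 2) := by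
  set c := d * volume.real (Metric.ball (0 : EuclideanSpace ℝ (Fin d)) 1)
  have hd0 : 0 < d := by omega
  have hc0 : 0 < c := mul_pos (by positivity)
    (ENNReal.toReal_pos (Metric.measure_ball_pos _ _ one_pos).ne' measure_ball_lt_top.ne)
  refine ⟨2 * (c * 2 + 2), fun ε ⟨h0, h1⟩ Ω hΩm hΩ f hf hs ↦ ?_⟩
  have hε := sq_le_theta_sq_mul_pow hd h0 h1
  have hθ : 0 < 2 * theta d ε ^ 2 :=
    pos_of_mul_pos_left ((pow_pos h0 2).trans_le hε) (by positivity)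
  have hK : ∫ ξ in Metric.ball (0 : EuclideanSpace ℝ (Fin d)) ε⁻¹, (1 + ‖ξ‖ ^ 2)⁻¹ ≤
      c * (2 * theta d ε ^ 2) := by
    rw [integral_ball_inv_one_add_norm_sq hd0.ne' (inv_pos.2 h0)]
    gcongr
    exact intervalIntegral_le_theta_sq hd h0 h1
  refine (setIntegral_sq_le_of_volume_le hf hs hΩm (pow_pos h0 d) h0 hΩ hK
    (mul_pos hc0 hθ)).trans ?_
  refine mul_le_mul_of_nonneg_right ?_
    (integral_nonneg fun x ↦ add_nonneg (sq_nonneg _) (sq_nonneg _))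
  linarith
end

section
/- There exists a constant C such that for every q ∈ [2, ∞) and every compactly supported continuously differentiable function f : ℝ² → ℝ, one has ( ∫_{ℝ²} |f|^q dx )^{1/q} ≤ C √q ( ∫_{ℝ²} (f² + |∇f|²) dx )^{1/2}. -/
open MeasureTheory

open Set ENNReal

/-- **Young's convolution inequality** for an `L²` function, in terms of lower integrals. -/
lemma lintegral_convolution_rpow_le {G : Type*} [MeasurableSpace G] [AddCommGroup G]
    [MeasurableAdd₂ G] {μ : Measure G} [SFinite μ] [μ.IsAddLeftInvariant]
    {K g : G → ℝ≥0∞} (hK : Measurable K) (hg : Measurable g) {q r : ℝ} (hq : 2 ≤ q)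
    (hr : r = 2 * q / (q + 2)) :
    ∫⁻ x, (∫⁻ y, K y * g (x + y) ∂μ) ^ q ∂μ ≤
      (∫⁻ y, K y ^ r ∂μ) ^ (q / 2 + 1) * (∫⁻ y, g y ^ (2 : ℝ) ∂μ) ^ (q / 2) := by
  have hq0 : 0 < q := by linarith
  have hr0 : 0 ≤ r := by rw [hr]; positivity
  have hw : 0 ≤ 1 / 2 - 1 / q := by
    have : 1 / q ≤ 1 / 2 := one_div_le_one_div_of_le two_pos hq
    linarith
  set A := ∫⁻ y, K y ^ r ∂μ
  set B := ∫⁻ y, g y ^ (2 : ℝ) ∂μ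
  have hB (x : G) : ∫⁻ y, g (x + y) ^ (2 : ℝ) ∂μ = B :=
    lintegral_add_left_eq_self (fun y ↦ g y ^ (2 : ℝ)) x
  have holder (x : G) : ∫⁻ y, K y * g (x + y) ∂μ ≤
      (∫⁻ y, K y ^ r * g (x + y) ^ (2 : ℝ) ∂μ) ^ (1 / q) * A ^ (1 / 2 : ℝ) *
        B ^ (1 / 2 - 1 / q) := by
    have h := ENNReal.lintegral_prod_norm_pow_le (μ := μ) (Finset.univ : Finset (Fin 3))
      (f := ![fun y ↦ K y ^ r * g (x + y) ^ (2 : ℝ), fun y ↦ K y ^ r,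
        fun y ↦ g (x + y) ^ (2 : ℝ)]) (p := ![1 / q, 1 / 2, 1 / 2 - 1 / q])
      (by
        intro i _
        fin_cases i
        · exact ((hK.pow_const _).mul ((hg.comp (measurable_const_add x)).pow_const _)).aemeasurable
        · exact (hK.pow_const _).aemeasurable
        · exact ((hg.comp (measurable_const_add x)).pow_const _).aemeasurable)
      (by simp [Fin.sum_univ_three]; ring)
      (by
        intro i _
        fin_cases i
        · simpa using hq0.le
        · norm_num
        · simpa using hw)
    simp only [Fin.prod_univ_three, Matrix.cons_val_zero, Matrix.cons_val_one,
      Matrix.cons_val] at h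
    rw [hB x] at h
    refine le_trans (le_of_eq (lintegral_congr fun y ↦ ?_)) h
    rw [ENNReal.mul_rpow_of_nonneg _ _ (by positivity), ← ENNReal.rpow_mul, ← ENNReal.rpow_mul,
      ← ENNReal.rpow_mul, ← ENNReal.rpow_mul]
    calc K y * g (x + y)
        = K y ^ (r * (1 / q) + r * (1 / 2)) * g (x + y) ^ (2 * (1 / q) + 2 * (1 / 2 - 1 / q)) := by
          have e1 : r * (1 / q) + r * (1 / 2) = 1 := by rw [hr]; field_simp; ring
          have e2 : 2 * (1 / q) + 2 * (1 / 2 - 1 / q) = 1 := by ring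
          rw [e1, e2, ENNReal.rpow_one, ENNReal.rpow_one]
      _ = _ := by
          rw [ENNReal.rpow_add_of_nonneg _ _ (by positivity) (by positivity),
            ENNReal.rpow_add_of_nonneg _ _ (by positivity) (by positivity)]
          ring
  calc ∫⁻ x, (∫⁻ y, K y * g (x + y) ∂μ) ^ q ∂μ
      ≤ ∫⁻ x, (∫⁻ y, K y ^ r * g (x + y) ^ (2 : ℝ) ∂μ) *
          (A ^ (q / 2) * B ^ (q / 2 - 1)) ∂μ := by
        refine lintegral_mono fun x ↦ (ENNReal.rpow_le_rpow (holder x) hq0.le).trans_eq ?_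
        rw [ENNReal.mul_rpow_of_nonneg _ _ hq0.le, ENNReal.mul_rpow_of_nonneg _ _ hq0.le,
          ← ENNReal.rpow_mul, ← ENNReal.rpow_mul, ← ENNReal.rpow_mul, mul_assoc]
        have e1 : 1 / q * q = 1 := by field_simp
        have e2 : 1 / 2 * q = q / 2 := by ring
        have e3 : (1 / 2 - 1 / q) * q = q / 2 - 1 := by field_simp
        rw [e1, e2, e3, ENNReal.rpow_one]
    _ = (∫⁻ x, ∫⁻ y, K y ^ r * g (x + y) ^ (2 : ℝ) ∂μ ∂μ) *
          (A ^ (q / 2) * B ^ (q / 2 - 1)) := by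
        refine lintegral_mul_const _ (Measurable.lintegral_prod_right ?_)
        fun_prop
    _ = (A * B) * (A ^ (q / 2) * B ^ (q / 2 - 1)) := by
        congr 1
        rw [lintegral_lintegral_swap (by fun_prop), ← lintegral_mul_const _ (hK.pow_const _)]
        refine lintegral_congr fun y ↦ ?_
        rw [lintegral_const_mul _ (by fun_prop)]
        simp_rw [add_comm _ y]
        rw [hB y]
    _ = A ^ (q / 2 + 1) * B ^ (q / 2) := by
        have e : q / 2 = (q / 2 - 1) + 1 := by ring
        rw [ENNReal.rpow_add_of_nonneg _ 1 (by positivity) zero_le_one, ENNReal.rpow_one]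
        conv_rhs => rw [e, ENNReal.rpow_add_of_nonneg (x := B) _ 1 (by linarith) zero_le_one,
          ENNReal.rpow_one, ← e]
        ring

/-- The Riesz kernel `‖y‖⁻¹`, truncated to the closed unit ball. -/
noncomputable def truncatedRieszKernel {E : Type*} [NormedAddCommGroup E] (y : E) : ℝ≥0∞ :=
  (Metric.closedBall 0 1).indicator (fun y ↦ ENNReal.ofReal ‖y‖⁻¹) y

lemma measurable_truncatedRieszKernel {E : Type*} [NormedAddCommGroup E] [MeasurableSpace E]
    [BorelSpace E] : Measurable (truncatedRieszKernel (E := E)) :=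
  Measurable.indicator (by fun_prop) Metric.isClosed_closedBall.measurableSet

/-- The unit vector at angle `θ` in the Euclidean plane. -/
noncomputable def planeUnitVector (θ : ℝ) : EuclideanSpace ℝ (Fin 2) :=
  Complex.orthonormalBasisOneI.repr (Real.cos θ + Real.sin θ * Complex.I)

lemma norm_planeUnitVector (θ : ℝ) : ‖planeUnitVector θ‖ = 1 := by
  rw [planeUnitVector, LinearIsometryEquiv.norm_map]
  push_cast
  rw [← Complex.exp_mul_I, Complex.norm_exp_ofReal_mul_I]

/-- Polar coordinates in the Euclidean plane. -/
lemma lintegral_eq_lintegral_planeUnitVector {F : EuclideanSpace ℝ (Fin 2) → ℝ≥0∞}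
    (hF : Measurable F) :
    ∫⁻ y, F y = ∫⁻ θ in Ioo (-Real.pi) Real.pi, ∫⁻ t in Ioi (0 : ℝ),
      ENNReal.ofReal t * F (t • planeUnitVector θ) := by
  let e := Complex.orthonormalBasisOneI.repr
  have hsymm (p : ℝ × ℝ) : e (Complex.polarCoord.symm p) = p.1 • planeUnitVector p.2 := by
    rw [Complex.polarCoord_symm_apply, planeUnitVector, ← map_smul]
    simp [e, mul_add]
  have hcont : Continuous fun p : ℝ × ℝ ↦ p.1 • planeUnitVector p.2 := by
    unfold planeUnitVector
    fun_prop
  rw [← e.measurePreserving.lintegral_comp hF, ← Complex.lintegral_comp_polarCoord_symm]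
  simp_rw [hsymm, smul_eq_mul]
  rw [polarCoord_target, Measure.volume_eq_prod, setLIntegral_prod_symm]
  exact ((measurable_fst.ennreal_ofReal).mul (hF.comp hcont.measurable)).aemeasurable

lemma truncatedRieszKernel_smul_planeUnitVector {t : ℝ} (ht : 0 < t) (θ : ℝ) :
    truncatedRieszKernel (t • planeUnitVector θ) =
      (Iic (1 : ℝ)).indicator (fun t ↦ ENNReal.ofReal t⁻¹) t := by
  have h : ‖t • planeUnitVector θ‖ = t := by
    rw [norm_smul, norm_planeUnitVector, mul_one, Real.norm_of_nonneg ht.le]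
  have hmem : t • planeUnitVector θ ∈ Metric.closedBall 0 1 ↔ t ∈ Iic (1 : ℝ) := by
    rw [mem_closedBall_zero_iff, h, mem_Iic]
  by_cases ht1 : t ∈ Iic (1 : ℝ)
  · rw [truncatedRieszKernel, indicator_of_mem (hmem.2 ht1), indicator_of_mem ht1, h]
  · rw [truncatedRieszKernel, indicator_of_notMem (mt hmem.1 ht1), indicator_of_notMem ht1]

lemma lintegral_truncatedRieszKernel_rpow {r : ℝ} (hr0 : 0 < r) (hr : r < 2) :
    ∫⁻ y : EuclideanSpace ℝ (Fin 2), truncatedRieszKernel y ^ r =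
      ENNReal.ofReal (2 * Real.pi / (2 - r)) := by
  rw [lintegral_eq_lintegral_planeUnitVector (measurable_truncatedRieszKernel.pow_const r)]
  have hint : IntegrableOn (fun t : ℝ ↦ t ^ (1 - r)) (Ioc 0 1) := by
    rw [← intervalIntegrable_iff_integrableOn_Ioc_of_le zero_le_one]
    exact intervalIntegral.intervalIntegrable_rpow' (by linarith)
  have inner (θ : ℝ) : ∫⁻ t in Ioi (0 : ℝ),
      ENNReal.ofReal t * truncatedRieszKernel (t • planeUnitVector θ) ^ r =
        ENNReal.ofReal (1 / (2 - r)) := by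
    calc _ = ∫⁻ t in Ioi (0 : ℝ),
          (Iic (1 : ℝ)).indicator (fun t ↦ ENNReal.ofReal (t ^ (1 - r))) t := by
          refine setLIntegral_congr_fun measurableSet_Ioi fun t (ht : 0 < t) ↦ ?_
          simp only [truncatedRieszKernel_smul_planeUnitVector ht, indicator_apply]
          split_ifs
          · rw [ENNReal.ofReal_rpow_of_nonneg (by positivity) hr0.le,
              ← ENNReal.ofReal_mul ht.le, Real.rpow_sub ht, Real.rpow_one,
              Real.inv_rpow ht.le, div_eq_mul_inv]
          · simp [hr0]
      _ = ∫⁻ t in Ioc (0 : ℝ) 1, ENNReal.ofReal (t ^ (1 - r)) := by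
          rw [setLIntegral_indicator measurableSet_Iic, inter_comm, Ioi_inter_Iic]
      _ = ENNReal.ofReal (∫ t in (0 : ℝ)..1, t ^ (1 - r)) := by
          rw [intervalIntegral.integral_of_le zero_le_one, ofReal_integral_eq_lintegral_ofReal hint]
          exact (ae_restrict_iff' measurableSet_Ioc).2
            (.of_forall fun t ht ↦ Real.rpow_nonneg ht.1.le _)
      _ = _ := by
          rw [integral_rpow (.inl (by linarith)), Real.one_rpow, Real.zero_rpow (by linarith)]
          ring_nf
  simp_rw [inner]
  rw [setLIntegral_const, Real.volume_Ioo, ← ENNReal.ofReal_mul (by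
    have : 0 < 2 - r := by linarith
    positivity)]
  ring_nf

/-- A `C¹` function is controlled at `x` by itself and its derivative along
a unit segment issued from `x`. -/
lemma enorm_le_lintegral_segment {E : Type*} [NormedAddCommGroup E] [NormedSpace ℝ E]
    {f : E → ℝ} (hf : ContDiff ℝ 1 f) (x : E) {v : E} (hv : ‖v‖ = 1) :
    ‖f x‖ₑ ≤ ∫⁻ t in Ioc (0 : ℝ) 1, (‖f (x + t • v)‖ₑ + ‖fderiv ℝ f (x + t • v)‖ₑ) := by
  have hderiv (t : ℝ) : HasDerivAt (fun t : ℝ ↦ (1 - t) * f (x + t • v))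
      (-1 * f (x + t • v) + (1 - t) * fderiv ℝ f (x + t • v) v) t := by
    have h1 : HasDerivAt (fun t : ℝ ↦ x + t • v) v t := by
      simpa using ((hasDerivAt_id t).smul_const v).const_add x
    exact ((hasDerivAt_id t).const_sub 1).mul
      ((hf.differentiable one_ne_zero _).hasFDerivAt.comp_hasDerivAt t h1)
  have hcont : Continuous fun t : ℝ ↦
      -1 * f (x + t • v) + (1 - t) * fderiv ℝ f (x + t • v) v := by
    have := hf.continuous
    have := hf.continuous_fderiv one_ne_zero
    fun_prop
  have hftc := intervalIntegral.integral_eq_sub_of_hasDerivAt (a := 0) (b := 1)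
    (fun t _ ↦ hderiv t) (hcont.intervalIntegrable _ _)
  simp only [sub_self, zero_mul, zero_smul, add_zero, sub_zero, one_mul, zero_sub] at hftc
  rw [← enorm_neg, ← hftc, intervalIntegral.integral_of_le zero_le_one]
  refine (enorm_integral_le_lintegral_enorm _).trans
    (setLIntegral_mono' measurableSet_Ioc fun t ht ↦ ?_)
  refine (enorm_add_le _ _).trans ?_
  gcongr
  · simp
  · rw [enorm_mul]
    refine (mul_le_mul' (?_ : _ ≤ (1 : ℝ≥0∞))
      ((fderiv ℝ f (x + t • v)).le_opENorm v)).trans ?_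
    · rw [Real.enorm_of_nonneg (by linarith [ht.2])]
      exact ENNReal.ofReal_le_one.2 (by linarith [ht.1])
    · have : ‖v‖ₑ = 1 := by rw [← ofReal_norm, hv, ENNReal.ofReal_one]
      simp [this]

/-- A `C¹` function on the plane is dominated by the convolution of the truncated Riesz kernel
with `|f| + |∇f|`. -/
lemma enorm_le_lintegral_truncatedRieszKernel {f : EuclideanSpace ℝ (Fin 2) → ℝ}
    (hf : ContDiff ℝ 1 f) (x : EuclideanSpace ℝ (Fin 2)) :
    ‖f x‖ₑ ≤ ∫⁻ y, truncatedRieszKernel y * (‖f (x + y)‖ₑ + ‖fderiv ℝ f (x + y)‖ₑ) := by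
  have hc := hf.continuous
  have hc' := hf.continuous_fderiv one_ne_zero
  rw [lintegral_eq_lintegral_planeUnitVector
    (F := fun y ↦ truncatedRieszKernel y * (‖f (x + y)‖ₑ + ‖fderiv ℝ f (x + y)‖ₑ))
    (measurable_truncatedRieszKernel.mul (by fun_prop))]
  calc ‖f x‖ₑ ≤ ∫⁻ θ in Ioo (-Real.pi) Real.pi, ‖f x‖ₑ := by
        rw [setLIntegral_const, Real.volume_Ioo]
        refine le_mul_of_one_le_right' (ENNReal.one_le_ofReal.2 ?_)
        linarith [Real.pi_gt_three]
    _ ≤ _ := by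
        refine lintegral_mono fun θ ↦
          (enorm_le_lintegral_segment hf x (norm_planeUnitVector θ)).trans_eq ?_
        rw [← Ioi_inter_Iic, inter_comm, ← setLIntegral_indicator measurableSet_Iic]
        refine setLIntegral_congr_fun measurableSet_Ioi fun t (ht : 0 < t) ↦ ?_
        simp only [truncatedRieszKernel_smul_planeUnitVector ht, indicator_apply]
        split_ifs
        · rw [← mul_assoc, ← ENNReal.ofReal_mul ht.le, mul_inv_cancel₀ ht.ne',
            ENNReal.ofReal_one, one_mul]
        · simp

lemma lintegral_enorm_add_enorm_fderiv_sq_le {f : EuclideanSpace ℝ (Fin 2) → ℝ}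
    (hf : ContDiff ℝ 1 f) (hfs : HasCompactSupport f) :
    ∫⁻ y, (‖f y‖ₑ + ‖fderiv ℝ f y‖ₑ) ^ (2 : ℝ) ≤
      ENNReal.ofReal (2 * ∫ x, ((f x) ^ 2 + ‖fderiv ℝ f x‖ ^ 2)) := by
  have hc := hf.continuous
  have hc' := hf.continuous_fderiv one_ne_zero
  have hint : Integrable fun x ↦ 2 * ((f x) ^ 2 + ‖fderiv ℝ f x‖ ^ 2) := by
    refine Continuous.integrable_of_hasCompactSupport (by fun_prop) ?_
    refine HasCompactSupport.intro hfs fun x hx ↦ ?_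
    have h1 : f x = 0 := image_eq_zero_of_notMem_tsupport hx
    have h2 : fderiv ℝ f x = 0 :=
      image_eq_zero_of_notMem_tsupport fun h ↦ hx (tsupport_fderiv_subset ℝ h)
    simp [h1, h2]
  rw [← integral_const_mul, ofReal_integral_eq_lintegral_ofReal hint
    (.of_forall fun x ↦ by positivity)]
  refine lintegral_mono fun x ↦ ?_
  rw [← ofReal_norm, ← ofReal_norm, ← ENNReal.ofReal_add (by positivity) (by positivity),
    ENNReal.ofReal_rpow_of_nonneg (by positivity) two_pos.le, Real.rpow_two]
  refine ENNReal.ofReal_le_ofReal (add_sq_le.trans_eq ?_)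
  rw [Real.norm_eq_abs, sq_abs]

lemma integral_abs_rpow_le {f : EuclideanSpace ℝ (Fin 2) → ℝ} (hf : ContDiff ℝ 1 f)
    (hfs : HasCompactSupport f) {q : ℝ} (hq : 2 ≤ q) :
    ∫ x, |f x| ^ q ≤ (Real.pi * q) ^ (q / 2 + 1) *
      (2 * ∫ x, ((f x) ^ 2 + ‖fderiv ℝ f x‖ ^ 2)) ^ (q / 2) := by
  have hq0 : 0 < q := by linarith
  have hc := hf.continuous
  have hc' := hf.continuous_fderiv one_ne_zero
  have hI : 0 ≤ ∫ x, ((f x) ^ 2 + ‖fderiv ℝ f x‖ ^ 2) := integral_nonneg fun x ↦ by positivity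
  have hr0 : 0 < 2 * q / (q + 2) := by positivity
  have hr2 : 2 * q / (q + 2) < 2 := by rw [div_lt_iff₀ (by positivity)]; linarith
  have hK : ∫⁻ y : EuclideanSpace ℝ (Fin 2), truncatedRieszKernel y ^ (2 * q / (q + 2)) ≤
      ENNReal.ofReal (Real.pi * q) := by
    rw [lintegral_truncatedRieszKernel_rpow hr0 hr2]
    refine ENNReal.ofReal_le_ofReal ?_
    have e : 2 * Real.pi / (2 - 2 * q / (q + 2)) = Real.pi * ((q + 2) / 2) := by
      have : 2 - 2 * q / (q + 2) = 4 / (q + 2) := by field_simp; ring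
      rw [this]; field_simp; ring
    rw [e]
    gcongr
    linarith
  rw [integral_eq_lintegral_of_nonneg_ae (.of_forall fun x ↦ by positivity)
    (hc.abs.rpow_const fun _ ↦ .inr hq0.le).aestronglyMeasurable]
  refine ENNReal.toReal_le_of_le_ofReal (by positivity) ?_
  calc ∫⁻ x, ENNReal.ofReal (|f x| ^ q)
      ≤ ∫⁻ x, (∫⁻ y, truncatedRieszKernel y *
          (‖f (x + y)‖ₑ + ‖fderiv ℝ f (x + y)‖ₑ)) ^ q := by
        refine lintegral_mono fun x ↦ ?_
        rw [← ENNReal.ofReal_rpow_of_nonneg (abs_nonneg _) hq0.le, ← Real.norm_eq_abs, ofReal_norm]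
        exact ENNReal.rpow_le_rpow (enorm_le_lintegral_truncatedRieszKernel hf x) hq0.le
    _ ≤ _ := lintegral_convolution_rpow_le (g := fun y ↦ ‖f y‖ₑ + ‖fderiv ℝ f y‖ₑ)
        measurable_truncatedRieszKernel (by fun_prop) hq rfl
    _ ≤ ENNReal.ofReal (Real.pi * q) ^ (q / 2 + 1) *
          ENNReal.ofReal (2 * ∫ x, ((f x) ^ 2 + ‖fderiv ℝ f x‖ ^ 2)) ^ (q / 2) := by
        gcongr
        exact lintegral_enorm_add_enorm_fderiv_sq_le hf hfs
    _ = _ := by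
        rw [ENNReal.ofReal_rpow_of_nonneg (by positivity) (by positivity),
          ENNReal.ofReal_rpow_of_nonneg (by positivity) (by positivity),
          ← ENNReal.ofReal_mul (by positivity)]

/-- Gagliardo–Nirenberg-type inequality in dimension two with constant growing like `√q`:
`‖f‖_{L^q} ≤ C √q ‖f‖_{W¹}` for all `q ∈ [2, ∞)`. -/
theorem gagliardo_nirenberg_dim_two :
    ∃ C : ℝ, ∀ q : ℝ, 2 ≤ q →
      ∀ f : EuclideanSpace ℝ (Fin 2) → ℝ, ContDiff ℝ 1 f → HasCompactSupport f →
        (∫ x, |f x| ^ q) ^ (1 / q) ≤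
          C * Real.sqrt q * Real.sqrt (∫ x, ((f x) ^ 2 + ‖fderiv ℝ f x‖ ^ 2)) := by
  refine ⟨8 * Real.sqrt Real.pi * Real.sqrt 2, fun q hq f hf hfs ↦ ?_⟩
  have hq0 : 0 < q := by linarith
  have hI : 0 ≤ ∫ x, ((f x) ^ 2 + ‖fderiv ℝ f x‖ ^ 2) := integral_nonneg fun x ↦ by positivity
  have hpos : 0 < Real.pi * q := by positivity
  have hroot : (Real.pi * q) ^ (1 / q) ≤ 8 := by
    rw [one_div, Real.rpow_inv_le_iff_of_pos hpos.le (by norm_num) hq0]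
    have h4 : Real.pi ≤ 4 ^ q :=
      Real.pi_le_four.trans (Real.self_le_rpow_of_one_le (by norm_num) (by linarith))
    have h2 : q ≤ 2 ^ q := by
      have := one_add_mul_self_le_rpow_one_add (s := 1) (by norm_num) (p := q) (by linarith)
      norm_num at this
      linarith
    calc Real.pi * q ≤ 4 ^ q * 2 ^ q := by gcongr
      _ = 8 ^ q := by rw [← Real.mul_rpow (by norm_num) (by norm_num)]; norm_num
  calc (∫ x, |f x| ^ q) ^ (1 / q)
      ≤ ((Real.pi * q) ^ (q / 2 + 1) *
          (2 * ∫ x, ((f x) ^ 2 + ‖fderiv ℝ f x‖ ^ 2)) ^ (q / 2)) ^ (1 / q) :=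
        Real.rpow_le_rpow (integral_nonneg fun x ↦ by positivity)
          (integral_abs_rpow_le hf hfs hq) (by positivity)
    _ = (Real.pi * q) ^ (1 / q) * Real.sqrt (Real.pi * q) *
          Real.sqrt (2 * ∫ x, ((f x) ^ 2 + ‖fderiv ℝ f x‖ ^ 2)) := by
        rw [Real.mul_rpow (by positivity) (by positivity), ← Real.rpow_mul hpos.le,
          ← Real.rpow_mul (by positivity), Real.sqrt_eq_rpow, Real.sqrt_eq_rpow,
          ← Real.rpow_add hpos]
        congr 2
        all_goals field_simp
        ring
    _ ≤ 8 * Real.sqrt (Real.pi * q) *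
          Real.sqrt (2 * ∫ x, ((f x) ^ 2 + ‖fderiv ℝ f x‖ ^ 2)) := by gcongr
    _ = _ := by
        rw [Real.sqrt_mul Real.pi_pos.le, Real.sqrt_mul zero_le_two]
        ring
end

section
/- Let X be a topological space, let a < b be real numbers, and let f : X × [a, b] → ℝ be continuous such that for each x ∈ X the function t ↦ f(x, t) is strictly increasing, and f(x, a) < 0 < f(x, b) for all x ∈ X. Then there is a unique function t₀ : X → (a, b) with f(x, t₀(x)) = 0 for all x ∈ X, and t₀ is continuous. -/
/-- Continuous dependence of the unique zero of a strictly monotone family of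
functions on a parameter. -/
theorem unique_zero_continuous {X : Type*} [TopologicalSpace X] (a b : ℝ) (hab : a < b)
    (f : X × ℝ → ℝ) (hf : ContinuousOn f (Set.univ ×ˢ Set.Icc a b))
    (hmono : ∀ x : X, StrictMonoOn (fun t => f (x, t)) (Set.Icc a b))
    (hfa : ∀ x, f (x, a) < 0) (hfb : ∀ x, 0 < f (x, b)) :
    ∃ t₀ : X → ℝ,
      (∀ x, t₀ x ∈ Set.Ioo a b ∧ f (x, t₀ x) = 0) ∧
      Continuous t₀ ∧
      (∀ t₁ : X → ℝ, (∀ x, t₁ x ∈ Set.Ioo a b ∧ f (x, t₁ x) = 0) → t₁ = t₀) := by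
  have hslice : ∀ t ∈ Set.Icc a b, Continuous fun x => f (x, t) := fun t ht =>
    hf.comp_continuous (by fun_prop) fun x => ⟨Set.mem_univ x, ht⟩
  have hex : ∀ x, ∃ t ∈ Set.Ioo a b, f (x, t) = 0 := fun x =>
    intermediate_value_Ioo hab.le
      (hf.comp (by fun_prop) fun t ht => ⟨Set.mem_univ x, ht⟩ :
        ContinuousOn (fun t => f (x, t)) (Set.Icc a b)) ⟨hfa x, hfb x⟩
  choose t₀ ht₀ hzero using hex
  have hmem : ∀ x, t₀ x ∈ Set.Icc a b := fun x => Set.Ioo_subset_Icc_self (ht₀ x)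
  have hlt : ∀ x, ∀ c ∈ Set.Icc a b, f (x, c) < 0 ↔ c < t₀ x := fun x c hc => by
    simpa only [hzero] using (hmono x).lt_iff_lt hc (hmem x)
  have hgt : ∀ x, ∀ c ∈ Set.Icc a b, 0 < f (x, c) ↔ t₀ x < c := fun x c hc => by
    simpa only [hzero] using (hmono x).lt_iff_lt (hmem x) hc
  refine ⟨t₀, fun x => ⟨ht₀ x, hzero x⟩, ?_, fun t₁ ht₁ => funext fun x =>
    (hmono x).injOn (Set.Ioo_subset_Icc_self (ht₁ x).1) (hmem x)
      ((ht₁ x).2.trans (hzero x).symm)⟩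
  refine continuous_iff_continuousAt.2 fun x => tendsto_order.2 ⟨fun c hc => ?_, fun c hc => ?_⟩
  · rcases lt_or_ge c a with hca | hac
    · exact .of_forall fun y => hca.trans (ht₀ y).1
    · have hcI : c ∈ Set.Icc a b := ⟨hac, hc.le.trans (hmem x).2⟩
      filter_upwards [(hslice c hcI).continuousAt.eventually_lt_const ((hlt x c hcI).2 hc)]
        with y hy using (hlt y c hcI).1 hy
  · rcases lt_or_ge b c with hbc | hcb
    · exact .of_forall fun y => (ht₀ y).2.trans hbc
    · have hcI : c ∈ Set.Icc a b := ⟨(hmem x).1.trans hc.le, hcb⟩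
      filter_upwards [(hslice c hcI).continuousAt.eventually_const_lt ((hgt x c hcI).2 hc)]
        with y hy using (hgt y c hcI).1 hy
end
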